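/- arXiv:1803.05475 — 8 statements merged into one kernel-verified Lean document; each statement's English description precedes it below -/
import Mathlib

section
/- Let f(s) = s² or f(s) = s⁴, and let u be a solution of ∂ₜu + ∂ₓ(∂ₓ²u + f(u)) = 0 satisfying the regularity and decay hypotheses that make the virial identity d/dt ∫_ℝ x·u(t,x) dx = ∫_ℝ f(u(t,x)) dx valid (u is C¹ in t, C³ in x; x·u(t,·), f(u(t,·)), ∂ₓ³u(t,·), x·∂ₜu(t,·) integrable; u and its first two x-derivatives, together with x·∂ₓ²u and x·f(u), vanish as |x| → ∞; x·∂ₜu locally uniformly dominated by an integrable function of x). If u is periodic in time with some period ω > 0, then u is identically zero. -/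
open MeasureTheory Filter Topology

/-- Integration by parts against the weight `x`: if `v` is `C³`, `g` is differentiable, and `v'`,
`x v''`, `x g` vanish at infinity, then `∫ x (v'' + g)' = -∫ g`. -/
lemma integral_id_mul_deriv_deriv_deriv_add
    {v g : ℝ → ℝ} (hv : ContDiff ℝ 3 v) (hg : Differentiable ℝ g)
    (hint : Integrable (fun x => x * deriv (fun y => deriv (deriv v) y + g y) x))
    (hint_g : Integrable g)
    (hdec_v : Tendsto (deriv v) (cocompact ℝ) (𝓝 0))
    (hdec_xv : Tendsto (fun x => x * deriv (deriv v) x) (cocompact ℝ) (𝓝 0))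
    (hdec_xg : Tendsto (fun x => x * g x) (cocompact ℝ) (𝓝 0)) :
    ∫ x, x * deriv (fun y => deriv (deriv v) y + g y) x = -∫ x, g x := by
  have h1 : ContDiff ℝ 2 (deriv v) := by
    have h : ContDiff ℝ (2 + 1) v := by convert hv using 1; norm_num
    exact (contDiff_succ_iff_deriv.1 h).2.2
  have h2 : ContDiff ℝ 1 (deriv (deriv v)) := by
    have h : ContDiff ℝ (1 + 1) (deriv v) := by convert h1 using 1; norm_num
    exact (contDiff_succ_iff_deriv.1 h).2.2
  have hd1 : Differentiable ℝ (deriv v) := h1.differentiable (by norm_num)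
  have hd2 : Differentiable ℝ (deriv (deriv v)) := h2.differentiable (by norm_num)
  have hderiv : ∀ x, HasDerivAt (fun x => x * (deriv (deriv v) x + g x) - deriv v x)
      (x * deriv (fun y => deriv (deriv v) y + g y) x + g x) x := by
    intro x
    have hG : HasDerivAt (fun y => deriv (deriv v) y + g y)
        (deriv (fun y => deriv (deriv v) y + g y) x) x :=
      ((hd2 x).add (hg x)).hasDerivAt
    exact (((hasDerivAt_id' x).mul hG).sub (hd1 x).hasDerivAt).congr_deriv (by ring)
  have hlim : Tendsto (fun x => x * (deriv (deriv v) x + g x) - deriv v x)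
      (cocompact ℝ) (𝓝 0) := by
    simpa [mul_add] using (hdec_xv.add hdec_xg).sub hdec_v
  have hzero := integral_of_hasDerivAt_of_tendsto hderiv (hint.add hint_g)
    (hlim.mono_left atBot_le_cocompact) (hlim.mono_left atTop_le_cocompact)
  rw [integral_add hint hint_g] at hzero
  linarith

/-- A periodic function with nonnegative derivative has zero derivative. -/
lemma Function.Periodic.eq_zero_of_hasDerivAt_of_nonneg {I I' : ℝ → ℝ} {ω : ℝ}
    (hper : Function.Periodic I ω) (hω : 0 < ω) (hI : ∀ t, HasDerivAt I (I' t) t)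
    (hnonneg : ∀ t, 0 ≤ I' t) (t : ℝ) : I' t = 0 := by
  have hmono : Monotone I :=
    monotone_of_deriv_nonneg (fun s => (hI s).differentiableAt)
      fun s => by rw [(hI s).deriv]; exact hnonneg s
  have hconst : I =ᶠ[𝓝 t] fun _ => I t := by
    filter_upwards [Ioo_mem_nhds (sub_lt_self t hω) (lt_add_of_pos_right t hω)] with s hs
    refine le_antisymm ?_ ?_
    · simpa only [hper t] using hmono hs.2.le
    · simpa only [hper.sub_eq t] using hmono hs.1.le
  exact (hI t).unique ((hasDerivAt_const t (I t)).congr_of_eventuallyEq hconst)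

/-- For f(s) = s² or f(s) = s⁴, a solution of generalized KdV satisfying the
hypotheses making the virial identity valid cannot be a nontrivial time periodic
solution. -/
theorem gkdv_no_breather_even_power
    (f : ℝ → ℝ) (hf : (∀ s : ℝ, f s = s ^ 2) ∨ (∀ s : ℝ, f s = s ^ 4))
    (u : ℝ → ℝ → ℝ)
    (hu_t : ∀ x, ContDiff ℝ 1 (fun t => u t x))
    (hu_x : ∀ t, ContDiff ℝ 3 (fun x => u t x))
    (heq : ∀ t x, deriv (fun s => u s x) t
        + deriv (fun y => deriv (deriv (u t)) y + f (u t y)) x = 0)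
    (hint_xu : ∀ t, Integrable (fun x => x * u t x))
    (hint_fu : ∀ t, Integrable (fun x => f (u t x)))
    (hint_uxxx : ∀ t, Integrable (fun x => deriv (deriv (deriv (u t))) x))
    (hint_xut : ∀ t, Integrable (fun x => x * deriv (fun s => u s x) t))
    (hdec_u : ∀ t, Tendsto (u t) (cocompact ℝ) (𝓝 0))
    (hdec_ux : ∀ t, Tendsto (deriv (u t)) (cocompact ℝ) (𝓝 0))
    (hdec_uxx : ∀ t, Tendsto (deriv (deriv (u t))) (cocompact ℝ) (𝓝 0))
    (hdec_xuxx : ∀ t, Tendsto (fun x => x * deriv (deriv (u t)) x) (cocompact ℝ) (𝓝 0))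
    (hdec_xfu : ∀ t, Tendsto (fun x => x * f (u t x)) (cocompact ℝ) (𝓝 0))
    (hdom : ∀ t₀ : ℝ, ∃ g : ℝ → ℝ, Integrable g ∧ ∃ δ > 0, ∀ t, |t - t₀| < δ →
        ∀ x, |x * deriv (fun s => u s x) t| ≤ g x)
    (ω : ℝ) (hω : 0 < ω)
    (hper : ∀ t x, u (t + ω) x = u t x) :
    ∀ t x, u t x = 0 := by
  have hf_cont : Continuous f := by
    rcases hf with h | h <;> rw [funext h] <;> fun_prop
  have hf_diff : Differentiable ℝ f := by
    rcases hf with h | h <;> rw [funext h] <;> fun_prop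
  have hf_nonneg : ∀ s, 0 ≤ f s := by
    rcases hf with h | h <;> intro s <;> rw [h] <;> positivity
  have hf_zero : ∀ s, f s = 0 → s = 0 := by
    rcases hf with h | h <;> intro s hs <;> rw [h] at hs <;>
      exact pow_eq_zero_iff (by norm_num) |>.1 hs
  have hvirial : ∀ t, HasDerivAt (fun t => ∫ x, x * u t x) (∫ x, f (u t x)) t := by
    intro t
    obtain ⟨g, hg, δ, hδ, hbound⟩ := hdom t
    have hderiv := (hasDerivAt_integral_of_dominated_loc_of_deriv_le (μ := volume)
      (F := fun t x => x * u t x) (F' := fun t x => x * deriv (fun s => u s x) t)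
      (Metric.ball_mem_nhds t hδ) (.of_forall fun s => (hint_xu s).aestronglyMeasurable)
      (hint_xu t) (hint_xut t).aestronglyMeasurable
      (.of_forall fun x s hs => hbound s (by simpa [Real.dist_eq] using hs) x) hg
      (.of_forall fun x s _ =>
        (((hu_t x).differentiable (by norm_num) s).hasDerivAt.const_mul x))).2
    have hut : ∀ x, x * deriv (fun s => u s x) t =
        -(x * deriv (fun y => deriv (deriv (u t)) y + f (u t y)) x) := fun x => by
      linear_combination x * heq t x
    have hint : Integrable
        (fun x => x * deriv (fun y => deriv (deriv (u t)) y + f (u t y)) x) := by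
      simpa [hut] using (hint_xut t).neg
    have hparts := integral_id_mul_deriv_deriv_deriv_add (hu_x t)
      (hf_diff.comp ((hu_x t).differentiable (by norm_num))) hint (hint_fu t)
      (hdec_ux t) (hdec_xuxx t) (hdec_xfu t)
    refine hderiv.congr_deriv ?_
    rw [integral_congr_ae (.of_forall hut), integral_neg]
    exact neg_eq_iff_eq_neg.2 hparts
  have hI_per : Function.Periodic (fun t => ∫ x, x * u t x) ω := fun t => by
    simp only [hper]
  intro t x
  have hzero := hI_per.eq_zero_of_hasDerivAt_of_nonneg hω hvirial
    (fun s => integral_nonneg fun y => hf_nonneg _) t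
  rw [integral_eq_zero_iff_of_nonneg (fun y => hf_nonneg _) (hint_fu t)] at hzero
  have hfu : (fun y => f (u t y)) = 0 :=
    (hf_cont.comp (hu_x t).continuous).ae_eq_iff_eq volume continuous_zero |>.1 hzero
  exact hf_zero _ (congrFun hfu x)
end

section
/- Let μ, ε be real numbers with 0 ≤ μ < 2ε, and let f(s) = s² + μ s³ + ε² s⁴ (or f(s) = s² − μ s³ + ε² s⁴). Let u be a solution of ∂ₜu + ∂ₓ(∂ₓ²u + f(u)) = 0 satisfying the regularity and decay hypotheses that make the virial identity d/dt ∫_ℝ x·u(t,x) dx = ∫_ℝ f(u(t,x)) dx valid (u is C¹ in t, C³ in x; x·u(t,·), f(u(t,·)), ∂ₓ³u(t,·), x·∂ₜu(t,·) integrable; u and its first two x-derivatives, together with x·∂ₓ²u and x·f(u), vanish as |x| → ∞; x·∂ₜu locally uniformly dominated by an integrable function of x). If u is periodic in time with some period ω > 0, then u is identically zero. -/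
open MeasureTheory Filter Topology

/-- If `c² < 4 ε²`, the quartic `s² + c s³ + ε² s⁴` is positive away from the origin. -/
lemma quartic_pos_of_ne_zero {c ε s : ℝ} (h : c ^ 2 < 4 * ε ^ 2) (hs : s ≠ 0) :
    0 < s ^ 2 + c * s ^ 3 + ε ^ 2 * s ^ 4 := by
  have h1 : 0 < s ^ 2 := by positivity
  have h2 : 0 < 1 + c * s + ε ^ 2 * s ^ 2 := by
    nlinarith [sq_nonneg (c * s + 2), mul_pos (sub_pos.2 h) h1]
  nlinarith [mul_pos h1 h2]

/-- The spatial part of the virial identity: if `v = -∂ₓ(w'' + g)`, then `∫ x v = ∫ g`. -/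
lemma integral_mul_id_eq_of_flux {w g v : ℝ → ℝ} (hw : ContDiff ℝ 3 w) (hg : Differentiable ℝ g)
    (heq : ∀ x, v x + deriv (fun y => deriv (deriv w) y + g y) x = 0)
    (hint_g : Integrable g) (hint_v : Integrable (fun x => x * v x))
    (hdec_w' : Tendsto (deriv w) (cocompact ℝ) (𝓝 0))
    (hdec_w'' : Tendsto (fun x => x * deriv (deriv w) x) (cocompact ℝ) (𝓝 0))
    (hdec_g : Tendsto (fun x => x * g x) (cocompact ℝ) (𝓝 0)) :
    ∫ x, x * v x = ∫ x, g x := by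
  have hw1 : ContDiff ℝ 2 (deriv w) := ((contDiff_succ_iff_deriv (n := 2)).1 hw).2.2
  have hw2 : ContDiff ℝ 1 (deriv (deriv w)) := ((contDiff_succ_iff_deriv (n := 1)).1 hw1).2.2
  have hderiv : ∀ x, HasDerivAt (fun x => deriv w x - (x * deriv (deriv w) x + x * g x))
      (x * v x - g x) x := by
    intro x
    have h1 := (hw1.differentiable (by norm_num) x).hasDerivAt
    have h2 := (((hw2.differentiable (by norm_num)).add hg) x).hasDerivAt
    have h3 := h1.sub ((hasDerivAt_id x).mul h2)
    have h4 : deriv (deriv (deriv w) + g) x = - v x := by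
      have := heq x
      change v x + deriv (deriv (deriv w) + g) x = 0 at this
      linarith
    rw [h4] at h3
    refine (h3.congr_deriv ?_).congr_of_eventuallyEq (Eventually.of_forall fun y => ?_)
    · simp
      ring
    · simp [mul_add]
  have hlim : Tendsto (fun x => deriv w x - (x * deriv (deriv w) x + x * g x))
      (cocompact ℝ) (𝓝 0) := by
    simpa using hdec_w'.sub (hdec_w''.add hdec_g)
  have h := integral_of_hasDerivAt_of_tendsto hderiv (hint_v.sub hint_g)
    (hlim.mono_left atBot_le_cocompact) (hlim.mono_left atTop_le_cocompact)
  rw [integral_sub hint_v hint_g] at h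
  linarith

/-- A periodic function with nonnegative derivative has vanishing derivative. -/
lemma deriv_eq_zero_of_periodic_of_nonneg {I I' : ℝ → ℝ} {ω : ℝ} (hω : 0 < ω)
    (hI : ∀ t, HasDerivAt I (I' t) t) (hnonneg : ∀ t, 0 ≤ I' t) (hper : Function.Periodic I ω)
    (t : ℝ) : I' t = 0 := by
  have hmono : Monotone I := monotone_of_hasDerivAt_nonneg hI hnonneg
  have hconst : I =ᶠ[𝓝 t] fun _ => I (t - ω / 2) := by
    filter_upwards [Ioo_mem_nhds (show t - ω / 2 < t by linarith)
      (show t < t + ω / 2 by linarith)] with s hs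
    refine le_antisymm ?_ (hmono hs.1.le)
    calc I s ≤ I (t - ω / 2 + ω) := hmono (by linarith [hs.2])
      _ = I (t - ω / 2) := hper _
  exact (hI t).unique ((hasDerivAt_const t _).congr_of_eventuallyEq hconst)

/-- For f(s) = s² ± μ s³ + ε² s⁴ with 0 ≤ μ < 2ε, a solution of generalized KdV
satisfying the hypotheses making the virial identity valid cannot be a nontrivial
time periodic solution. -/
theorem gkdv_no_breather_perturbed_gardner
    (μ ε : ℝ) (hμ : 0 ≤ μ) (hμε : μ < 2 * ε)
    (f : ℝ → ℝ)
    (hf : (∀ s : ℝ, f s = s ^ 2 + μ * s ^ 3 + ε ^ 2 * s ^ 4) ∨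
          (∀ s : ℝ, f s = s ^ 2 - μ * s ^ 3 + ε ^ 2 * s ^ 4))
    (u : ℝ → ℝ → ℝ)
    (hu_t : ∀ x, ContDiff ℝ 1 (fun t => u t x))
    (hu_x : ∀ t, ContDiff ℝ 3 (fun x => u t x))
    (heq : ∀ t x, deriv (fun s => u s x) t
        + deriv (fun y => deriv (deriv (u t)) y + f (u t y)) x = 0)
    (hint_xu : ∀ t, Integrable (fun x => x * u t x))
    (hint_fu : ∀ t, Integrable (fun x => f (u t x)))
    (hint_uxxx : ∀ t, Integrable (fun x => deriv (deriv (deriv (u t))) x))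
    (hint_xut : ∀ t, Integrable (fun x => x * deriv (fun s => u s x) t))
    (hdec_u : ∀ t, Tendsto (u t) (cocompact ℝ) (𝓝 0))
    (hdec_ux : ∀ t, Tendsto (deriv (u t)) (cocompact ℝ) (𝓝 0))
    (hdec_uxx : ∀ t, Tendsto (deriv (deriv (u t))) (cocompact ℝ) (𝓝 0))
    (hdec_xuxx : ∀ t, Tendsto (fun x => x * deriv (deriv (u t)) x) (cocompact ℝ) (𝓝 0))
    (hdec_xfu : ∀ t, Tendsto (fun x => x * f (u t x)) (cocompact ℝ) (𝓝 0))
    (hdom : ∀ t₀ : ℝ, ∃ g : ℝ → ℝ, Integrable g ∧ ∃ δ > 0, ∀ t, |t - t₀| < δ →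
        ∀ x, |x * deriv (fun s => u s x) t| ≤ g x)
    (ω : ℝ) (hω : 0 < ω)
    (hper : ∀ t x, u (t + ω) x = u t x) :
    ∀ t x, u t x = 0 := by
  have hsq : μ ^ 2 < 4 * ε ^ 2 := by nlinarith
  have hf_pos : ∀ s, s ≠ 0 → 0 < f s := by
    intro s hs
    rcases hf with h | h
    · rw [h]
      exact quartic_pos_of_ne_zero hsq hs
    · rw [h, sub_eq_add_neg, ← neg_mul]
      exact quartic_pos_of_ne_zero (by simpa using hsq) hs
  have hf_zero : f 0 = 0 := by rcases hf with h | h <;> simp [h]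
  have hf_nonneg : ∀ s, 0 ≤ f s := by
    intro s
    rcases eq_or_ne s 0 with rfl | hs
    · exact hf_zero.ge
    · exact (hf_pos s hs).le
  have hf_diff : Differentiable ℝ f := by
    rcases hf with h | h <;> rw [funext h] <;> fun_prop
  have hfu_diff : ∀ t, Differentiable ℝ (fun x => f (u t x)) := fun t =>
    hf_diff.comp ((hu_x t).differentiable (by norm_num))
  have hvirial : ∀ t, HasDerivAt (fun t => ∫ x, x * u t x) (∫ x, f (u t x)) t := by
    intro t
    obtain ⟨g, hg, δ, hδ, hbound⟩ := hdom t
    rw [← integral_mul_id_eq_of_flux (hu_x t) (hfu_diff t) (heq t) (hint_fu t) (hint_xut t)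
      (hdec_ux t) (hdec_xuxx t) (hdec_xfu t)]
    refine (hasDerivAt_integral_of_dominated_loc_of_deriv_le
      (F := fun t x => x * u t x) (F' := fun t x => x * deriv (fun s => u s x) t)
      (Metric.ball_mem_nhds t hδ) (Eventually.of_forall fun s => (hint_xu s).aestronglyMeasurable)
      (hint_xu t) (hint_xut t).aestronglyMeasurable (Eventually.of_forall fun x s hs => ?_) hg
      (Eventually.of_forall fun x s _ => ?_)).2
    · rw [Real.norm_eq_abs]
      exact hbound s (by simpa [Real.dist_eq] using hs) x
    · exact (((hu_t x).differentiable (by norm_num) s).hasDerivAt).const_mul x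
  intro t x
  have hzero := deriv_eq_zero_of_periodic_of_nonneg hω hvirial
    (fun s => integral_nonneg fun x => hf_nonneg _) (fun s => by simp only [hper]) t
  have hfu_zero : (fun x => f (u t x)) = 0 :=
    ((hfu_diff t).continuous.ae_eq_iff_eq volume continuous_zero).1
      ((integral_eq_zero_iff_of_nonneg (fun x => hf_nonneg _) (hint_fu t)).1 hzero)
  by_contra hne
  exact (hf_pos _ hne).ne' (congrFun hfu_zero x)
end

section
/- Let j ≥ 5 be an integer and f(s) = s^j + f_j(s), where f_j : ℝ → ℝ is C^j and f_j(s)/|s|^j → 0 as s → 0. Then there exists ε > 0 (depending on j and f_j) with the following property: if u is a solution of ∂ₜu + ∂ₓ(∂ₓ²u + f(u)) = 0 which is C¹ in t and C³ in x such that for each t the functions x·u(t,·)², u(t,·)², ∂ₓu(t,·)², G(u(t,·)), F(u(t,·)) and x·∂ₜ(u²)(t,·) are integrable, u(t,x) and ∂ₓu(t,x) vanish as |x| → ∞ together with the boundary terms x·u·∂ₓ²u, x·(∂ₓu)², x·G(u), u·∂ₓu, differentiation under the integral ∫ x u² dx in t is justified, and sup over t of ‖u(t,·)‖_{H¹} <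 ε, then u cannot be a nontrivial time periodic solution: if u is periodic in time with some period ω > 0, then u is identically zero. Here G(s) = ∫₀^s f(r) dr and F is determined by F'(s) = s f'(s), F(0) = 0. -/
open MeasureTheory Filter Topology

/-- One-dimensional Gagliardo–Nirenberg inequality `‖v‖_∞⁴ ≤ 4 ‖v‖₂² ‖∂ₓv‖₂²`. -/
theorem pow_four_le_integral_sq_mul_integral_deriv_sq {v : ℝ → ℝ} (hv : ContDiff ℝ 1 v)
    (h2 : Integrable (fun x => v x ^ 2)) (hd2 : Integrable (fun x => deriv v x ^ 2))
    (h0 : Tendsto v (cocompact ℝ) (𝓝 0)) (x : ℝ) :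
    v x ^ 4 ≤ 4 * (∫ y, v y ^ 2) * ∫ y, deriv v y ^ 2 := by
  have hvc := hv.continuous
  have hdc : Continuous (deriv v) := hv.continuous_deriv le_rfl
  have hderiv : ∀ y, HasDerivAt (fun y => v y ^ 2) (2 * (v y * deriv v y)) y := fun y =>
    (((hv.differentiable one_ne_zero y).hasDerivAt).pow 2).congr_deriv (by simp; ring)
  have hinteg : Integrable (fun y => 2 * (v y * deriv v y)) := by
    refine (h2.add hd2).mono' (by fun_prop) (Eventually.of_forall fun y => ?_)
    rw [Real.norm_eq_abs, abs_le]
    constructor <;> simp only [Pi.add_apply] <;>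
      nlinarith [sq_nonneg (v y - deriv v y), sq_nonneg (v y + deriv v y)]
  have hbot : Tendsto (fun y => v y ^ 2) atBot (𝓝 0) := by
    simpa using (h0.mono_left atBot_le_cocompact).pow 2
  have hq : ∫ y in Set.Iic x, 2 * (v y * deriv v y) = v x ^ 2 := by
    simpa using integral_Iic_of_hasDerivAt_of_tendsto' (fun y _ => hderiv y)
      hinteg.integrableOn hbot
  have key : ∀ l : ℝ, 0 ≤ (∫ y, v y ^ 2) * (l * l) + (-(v x ^ 2)) * l + ∫ y, deriv v y ^ 2 := by
    intro l
    have hs : Integrable (fun y => (l * l) * v y ^ 2 + deriv v y ^ 2) := (h2.const_mul _).add hd2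
    have h1 : ∫ y in Set.Iic x, l * (2 * (v y * deriv v y))
        ≤ ∫ y in Set.Iic x, ((l * l) * v y ^ 2 + deriv v y ^ 2) :=
      integral_mono (hinteg.const_mul l).integrableOn hs.integrableOn fun y => by
        simp only
        nlinarith [sq_nonneg (l * v y - deriv v y)]
    have h3 : ∫ y in Set.Iic x, ((l * l) * v y ^ 2 + deriv v y ^ 2)
        ≤ ∫ y, ((l * l) * v y ^ 2 + deriv v y ^ 2) :=
      setIntegral_le_integral hs (Eventually.of_forall fun y => by
        have := mul_self_nonneg l
        simp only [Pi.zero_apply]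
        positivity)
    rw [integral_add (h2.const_mul _) hd2, integral_const_mul] at h3
    rw [integral_const_mul, hq] at h1
    linarith
  have := discrim_le_zero key
  simp only [discrim] at this
  nlinarith

/-- `‖v‖_∞² ≤ ‖v‖²_{H¹}` in one dimension. -/
theorem sq_le_integral_sq_add_integral_deriv_sq {v : ℝ → ℝ} (hv : ContDiff ℝ 1 v)
    (h2 : Integrable (fun x => v x ^ 2)) (hd2 : Integrable (fun x => deriv v x ^ 2))
    (h0 : Tendsto v (cocompact ℝ) (𝓝 0)) (x : ℝ) :
    v x ^ 2 ≤ (∫ y, v y ^ 2) + ∫ y, deriv v y ^ 2 := by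
  have h := pow_four_le_integral_sq_mul_integral_deriv_sq hv h2 hd2 h0 x
  have hA : 0 ≤ ∫ y, v y ^ 2 := integral_nonneg fun y => sq_nonneg _
  have hB : 0 ≤ ∫ y, deriv v y ^ 2 := integral_nonneg fun y => sq_nonneg _
  refine abs_le_of_sq_le_sq' ?_ (by positivity) |>.2
  nlinarith [sq_nonneg ((∫ y, v y ^ 2) - ∫ y, deriv v y ^ 2)]

/-- If `f` is a small perturbation of `s ^ j` near `0`, then near `0` the product `s f(s)` is
controlled both by `|s| ^ (j + 1)` and by the primitive of `f`. -/
theorem exists_bounds_near_zero {j : ℕ} {h f G : ℝ → ℝ} (hc : Continuous h)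
    (hj : j ≠ 0) (hlim : Tendsto (fun s : ℝ => h s / |s| ^ j) (𝓝[≠] 0) (𝓝 0))
    (hf : ∀ s, f s = s ^ j + h s) (hG : ∀ s, G s = ∫ r in (0 : ℝ)..s, f r) :
    ∃ δ > 0, ∀ s, |s| < δ → |s * f s| ≤ 2 * |s| ^ (j + 1) ∧
      |G s| ≤ 2 * |s| ^ (j + 1) ∧ |s * f s| ≤ 4 * (j + 1) * |G s| := by
  have hη : (0 : ℝ) < 1 / (2 * (j + 1)) := by positivity
  have hη1 : (1 : ℝ) / (2 * (j + 1)) ≤ 1 := by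
    rw [div_le_one (by positivity)]
    have : (0 : ℝ) ≤ j := by positivity
    linarith
  obtain ⟨δ, hδ, hball⟩ := Metric.tendsto_nhdsWithin_nhds.1 hlim _ hη
  have hsmall : ∀ s, s ≠ 0 → |s| < δ → |h s| ≤ 1 / (2 * (j + 1)) * |s| ^ j := by
    intro s hs0 hs
    have := hball (x := s) (by simpa using hs0) (by simpa using hs)
    rw [dist_zero_right, Real.norm_eq_abs, abs_div, abs_of_nonneg (by positivity : 0 ≤ |s| ^ j),
      div_lt_iff₀ (by positivity)] at this
    exact this.le
  have hzero : h 0 = 0 := by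
    have ht : Tendsto h (𝓝[≠] 0) (𝓝 0) := by
      have hp : Tendsto (fun s : ℝ => |s| ^ j) (𝓝[≠] 0) (𝓝 0) := by
        have : Continuous (fun s : ℝ => |s| ^ j) := by fun_prop
        simpa [hj] using (this.tendsto 0).mono_left nhdsWithin_le_nhds
      have := hlim.mul hp
      rw [mul_zero] at this
      refine this.congr' ?_
      filter_upwards [self_mem_nhdsWithin] with s hs
      have : |s| ^ j ≠ 0 := pow_ne_zero _ (abs_ne_zero.2 hs)
      field_simp
    exact tendsto_nhds_unique ((hc.tendsto 0).mono_left nhdsWithin_le_nhds) ht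
  have hbound : ∀ s, |s| < δ → |h s| ≤ 1 / (2 * (j + 1)) * |s| ^ j := by
    intro s hs
    rcases eq_or_ne s 0 with rfl | hs0
    · simp [hzero, hj]
    · exact hsmall s hs0 hs
  refine ⟨δ, hδ, fun s hs => ?_⟩
  have hGs : |G s - s ^ (j + 1) / (j + 1)| ≤ 1 / (2 * (j + 1)) * |s| ^ (j + 1) := by
    have hI : G s = s ^ (j + 1) / (j + 1) + ∫ r in (0 : ℝ)..s, h r := by
      rw [hG]
      simp only [hf]
      rw [intervalIntegral.integral_add ((continuous_pow j).intervalIntegrable _ _)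
        (hc.intervalIntegrable _ _), integral_pow]
      simp
    rw [hI, add_sub_cancel_left]
    have := intervalIntegral.norm_integral_le_of_norm_le_const (a := 0) (b := s) (f := h)
      (C := 1 / (2 * (j + 1)) * |s| ^ j) (fun r hr => by
        have hrs : |r| ≤ |s| := by
          rcases le_total 0 s with h0 | h0
          · rw [Set.uIoc_of_le h0] at hr
            rw [abs_of_pos hr.1, abs_of_nonneg h0]
            exact hr.2
          · rw [Set.uIoc_of_ge h0] at hr
            rw [abs_of_nonpos hr.2, abs_of_nonpos h0]
            linarith [hr.1]
        exact (hbound r (hrs.trans_lt hs)).trans (by gcongr))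
    rw [sub_zero, Real.norm_eq_abs] at this
    exact this.trans_eq (by ring)
  have hlead : |s ^ (j + 1) / ((j : ℝ) + 1)| = 2 * (1 / (2 * (j + 1)) * |s| ^ (j + 1)) := by
    rw [abs_div, abs_pow, abs_of_pos (by positivity : (0 : ℝ) < j + 1)]
    field_simp
  have hP : 0 ≤ |s| ^ (j + 1) := by positivity
  have hηP : 1 / (2 * ((j : ℝ) + 1)) * |s| ^ (j + 1) ≤ |s| ^ (j + 1) :=
    mul_le_of_le_one_left hP hη1
  have hsf : |s * f s| ≤ 2 * |s| ^ (j + 1) := by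
    have h1 : |s * f s| ≤ |s| * (|s| ^ j + 1 / (2 * (j + 1)) * |s| ^ j) := by
      rw [abs_mul, hf]
      gcongr
      exact (abs_add_le _ _).trans (by rw [abs_pow]; gcongr; exact hbound s hs)
    calc _ ≤ _ := h1
      _ = |s| ^ (j + 1) + 1 / (2 * (j + 1)) * |s| ^ (j + 1) := by ring
      _ ≤ _ := by linarith
  have hlow : 1 / (2 * ((j : ℝ) + 1)) * |s| ^ (j + 1) ≤ |G s| := by
    have := abs_sub_abs_le_abs_sub (s ^ (j + 1) / ((j : ℝ) + 1)) (G s)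
    rw [abs_sub_comm] at this
    linarith
  have hup : |G s| ≤ 3 * (1 / (2 * ((j : ℝ) + 1)) * |s| ^ (j + 1)) := by
    have := abs_sub_abs_le_abs_sub (G s) (s ^ (j + 1) / ((j : ℝ) + 1))
    linarith
  refine ⟨hsf, hup.trans ?_, hsf.trans ?_⟩
  · have h12 : (1 : ℝ) / (2 * (j + 1)) ≤ 1 / 2 := by
      apply one_div_le_one_div_of_le (by norm_num)
      have : (0 : ℝ) ≤ j := by positivity
      linarith
    nlinarith [mul_le_mul_of_nonneg_right h12 hP]
  · calc 2 * |s| ^ (j + 1)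
        = 4 * (j + 1) * (1 / (2 * ((j : ℝ) + 1)) * |s| ^ (j + 1)) := by field_simp; ring
      _ ≤ _ := by gcongr

/-- Virial identity: the spatial integral of `x v ∂ₓ(∂ₓ²v + f(v))`, integrated by parts. -/
theorem integral_mul_deriv_gkdv_flux {f G F v : ℝ → ℝ} (hf : Differentiable ℝ f)
    (hG : ∀ s, HasDerivAt G (f s) s) (hF : ∀ s, F s = s * f s - G s)
    (hv : ContDiff ℝ 3 v)
    (hL : Integrable (fun x => x * (v x * deriv (fun y => deriv (deriv v) y + f (v y)) x)))
    (hd2 : Integrable (fun x => deriv v x ^ 2)) (hFi : Integrable (fun x => F (v x)))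
    (b1 : Tendsto (fun x => x * v x * deriv (deriv v) x) (cocompact ℝ) (𝓝 0))
    (b2 : Tendsto (fun x => x * deriv v x ^ 2) (cocompact ℝ) (𝓝 0))
    (b3 : Tendsto (fun x => x * G (v x)) (cocompact ℝ) (𝓝 0))
    (b4 : Tendsto (fun x => v x * deriv v x) (cocompact ℝ) (𝓝 0))
    (b5 : Tendsto (fun x => x * (v x * f (v x))) (cocompact ℝ) (𝓝 0)) :
    ∫ x, x * (v x * deriv (fun y => deriv (deriv v) y + f (v y)) x)
      = 3 / 2 * (∫ x, deriv v x ^ 2) - ∫ x, F (v x) := by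
  set w : ℝ → ℝ := fun y => deriv (deriv v) y + f (v y) with hw
  have hv1 : ContDiff ℝ 2 (deriv v) := (contDiff_succ_iff_deriv (n := 2)).1 hv |>.2.2
  have hv2 : ContDiff ℝ 1 (deriv (deriv v)) := (contDiff_succ_iff_deriv (n := 1)).1 hv1 |>.2.2
  have d0 : ∀ x, HasDerivAt v (deriv v x) x := fun x =>
    (hv.differentiable (by norm_num) x).hasDerivAt
  have d1 : ∀ x, HasDerivAt (deriv v) (deriv (deriv v) x) x := fun x =>
    (hv1.differentiable (by norm_num) x).hasDerivAt
  have dw : ∀ x, HasDerivAt w (deriv w x) x := fun x =>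
    ((hv2.differentiable (by norm_num)).add
      (hf.comp (hv.differentiable (by norm_num))) x).hasDerivAt
  have dG : ∀ x, HasDerivAt (fun x => G (v x)) (f (v x) * deriv v x) x := fun x =>
    (hG (v x)).comp x (d0 x)
  set Φ : ℝ → ℝ := fun x => x * (v x * w x) - x * deriv v x ^ 2 / 2 - x * G (v x)
    - v x * deriv v x with hΦ
  have dΦ : ∀ x, HasDerivAt Φ
      (x * (v x * deriv w x) - 3 / 2 * deriv v x ^ 2 + F (v x)) x := by
    intro x
    refine (((((hasDerivAt_id' x).mul ((d0 x).mul (dw x))).sub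
      (((hasDerivAt_id' x).mul ((d1 x).pow 2)).div_const 2)).sub
      ((hasDerivAt_id' x).mul (dG x))).sub ((d0 x).mul (d1 x))).congr_deriv ?_
    rw [hF]
    simp [hw]
    ring
  have hlim : Tendsto Φ (cocompact ℝ) (𝓝 0) := by
    have := ((((b1.add b5).sub (b2.div_const 2)).sub b3).sub b4)
    simp only [add_zero, sub_zero, zero_div] at this
    refine this.congr fun x => ?_
    simp only [hΦ, hw]
    ring
  have hI1 : Integrable (fun x => x * (v x * deriv w x) - 3 / 2 * deriv v x ^ 2) :=
    hL.sub (hd2.const_mul _)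
  have h0 := integral_of_hasDerivAt_of_tendsto dΦ (hI1.add hFi)
    (hlim.mono_left atBot_le_cocompact) (hlim.mono_left atTop_le_cocompact)
  rw [integral_add hI1 hFi, integral_sub hL (hd2.const_mul _), integral_const_mul] at h0
  linarith

/-- A differentiable periodic function with nonpositive derivative has zero derivative. -/
theorem deriv_eq_zero_of_periodic_of_nonpos {I I' : ℝ → ℝ} (hI : ∀ t, HasDerivAt I (I' t) t)
    (hI' : ∀ t, I' t ≤ 0) {ω : ℝ} (hω : 0 < ω) (hper : Function.Periodic I ω) (t : ℝ) :
    I' t = 0 := by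
  have hanti : Antitone I := antitone_of_deriv_nonpos (fun t => (hI t).differentiableAt)
    fun t => (hI t).deriv.trans_le (hI' t)
  have hle : ∀ s t, I s ≤ I t := by
    intro s t
    obtain ⟨n, hn⟩ := exists_nat_gt ((t - s) / ω)
    rw [div_lt_iff₀ hω] at hn
    rw [← hper.nat_mul n s]
    exact hanti (by linarith)
  have hconst : I = fun _ => I 0 := funext fun s => le_antisymm (hle s 0) (hle 0 s)
  have := hI t
  rw [hconst] at this
  exact this.unique (hasDerivAt_const t _)

/-- L² critical and supercritical cases: for f(s) = s^j + f_j(s), j ≥ 5, with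
f_j ∈ C^j and f_j(s)/|s|^j → 0 as s → 0, there is ε > 0 such that no solution of
generalized KdV satisfying the natural regularity/decay hypotheses and uniformly
smaller than ε in H¹ can be a nontrivial time periodic solution.  Here
G(s) = ∫₀^s f and F' (s) = s f'(s), F(0) = 0. -/
theorem gkdv_no_small_breather_supercritical
    (j : ℕ) (hj : 5 ≤ j)
    (fj : ℝ → ℝ) (hfj : ContDiff ℝ (j : ℕ) fj)
    (hlim : Tendsto (fun s : ℝ => fj s / |s| ^ j) (𝓝[≠] 0) (𝓝 0))
    (f : ℝ → ℝ) (hf : ∀ s : ℝ, f s = s ^ j + fj s)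
    (G : ℝ → ℝ) (hG : ∀ s : ℝ, G s = ∫ r in (0:ℝ)..s, f r)
    (F : ℝ → ℝ) (hF0 : F 0 = 0) (hF' : ∀ s : ℝ, HasDerivAt F (s * deriv f s) s) :
    ∃ ε > 0, ∀ u : ℝ → ℝ → ℝ,
      (∀ x, ContDiff ℝ 1 (fun t => u t x)) →
      (∀ t, ContDiff ℝ 3 (fun x => u t x)) →
      (∀ t x, deriv (fun s => u s x) t
          + deriv (fun y => deriv (deriv (u t)) y + f (u t y)) x = 0) →
      (∀ t, Integrable (fun x => x * (u t x) ^ 2)) →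
      (∀ t, Integrable (fun x => (u t x) ^ 2)) →
      (∀ t, Integrable (fun x => (deriv (u t) x) ^ 2)) →
      (∀ t, Integrable (fun x => G (u t x))) →
      (∀ t, Integrable (fun x => F (u t x))) →
      (∀ t, Integrable (fun x => x * deriv (fun s => (u s x) ^ 2) t)) →
      (∀ t, Tendsto (u t) (cocompact ℝ) (𝓝 0)) →
      (∀ t, Tendsto (deriv (u t)) (cocompact ℝ) (𝓝 0)) →
      (∀ t, Tendsto (fun x => x * u t x * deriv (deriv (u t)) x) (cocompact ℝ) (𝓝 0)) →
      (∀ t, Tendsto (fun x => x * (deriv (u t) x) ^ 2) (cocompact ℝ) (𝓝 0)) →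
      (∀ t, Tendsto (fun x => x * G (u t x)) (cocompact ℝ) (𝓝 0)) →
      (∀ t, Tendsto (fun x => u t x * deriv (u t) x) (cocompact ℝ) (𝓝 0)) →
      (∀ t₀ : ℝ, ∃ g : ℝ → ℝ, Integrable g ∧ ∃ δ > 0, ∀ t, |t - t₀| < δ →
          ∀ x, |x * deriv (fun s => (u s x) ^ 2) t| ≤ g x) →
      (∀ t, Real.sqrt (∫ x, ((u t x) ^ 2 + (deriv (u t) x) ^ 2)) < ε) →
      ∀ ω > 0, (∀ t x, u (t + ω) x = u t x) → ∀ t x, u t x = 0 := by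
  have hfdiff : Differentiable ℝ f := by
    have : f = fun s => s ^ j + fj s := funext hf
    rw [this]
    exact (differentiable_pow j).add
      (hfj.differentiable (by exact_mod_cast (by omega : j ≠ 0)))
  have hGderiv : ∀ s, HasDerivAt G (f s) s := by
    intro s
    rw [funext hG]
    exact intervalIntegral.integral_hasDerivAt_right (hfdiff.continuous.intervalIntegrable _ _)
      (hfdiff.continuous.stronglyMeasurableAtFilter _ _) hfdiff.continuous.continuousAt
  have hFeq : ∀ s, F s = s * f s - G s := by
    have hd : ∀ s, HasDerivAt (fun s => F s - (s * f s - G s)) 0 s := fun s =>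
      ((hF' s).sub (((hasDerivAt_id' s).mul (hfdiff s).hasDerivAt).sub (hGderiv s))).congr_deriv
        (by simp)
    intro s
    have := is_const_of_deriv_eq_zero (fun s => (hd s).differentiableAt)
      (fun s => (hd s).deriv) s 0
    have hG0 : G 0 = 0 := by simp [hG]
    simp only [hF0, hG0] at this
    linarith
  obtain ⟨δ, hδ, hbounds⟩ :=
    exists_bounds_near_zero hfj.continuous (by omega) hlim hf hG
  refine ⟨min δ (1 / 2), by positivity, ?_⟩
  intro u hut hux heq hxu hu2 hdu2 _ hFi hxdt hu0 _ b1 b2 b3 b4 hdom hsmall ω hω hper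
  have hu1 : ∀ t, ContDiff ℝ 1 (u t) := fun t => (hux t).of_le (by norm_num)
  have hB : ∀ t, 0 ≤ ∫ y, deriv (u t) y ^ 2 := fun t => integral_nonneg fun y => sq_nonneg _
  have hA : ∀ t, 0 ≤ ∫ y, u t y ^ 2 := fun t => integral_nonneg fun y => sq_nonneg _
  have hH1 : ∀ t, (∫ y, u t y ^ 2) + (∫ y, deriv (u t) y ^ 2) < min δ (1 / 2) ^ 2 := by
    intro t
    rw [← integral_add (hu2 t) (hdu2 t)]
    exact (Real.sqrt_lt' (by positivity)).1 (hsmall t)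
  have hsup : ∀ t x, |u t x| < min δ (1 / 2) := fun t x =>
    abs_lt_of_sq_lt_sq ((sq_le_integral_sq_add_integral_deriv_sq (hu1 t) (hu2 t) (hdu2 t)
      (hu0 t) x).trans_lt (hH1 t)) (by positivity)
  have hut' : ∀ t x, HasDerivAt (fun s => u s x ^ 2) (deriv (fun s => u s x ^ 2) t) t :=
    fun t x => (((hut x).differentiable one_ne_zero t).pow 2).hasDerivAt
  have hsq : ∀ t x, x * deriv (fun s => u s x ^ 2) t
      = -2 * (x * (u t x * deriv (fun y => deriv (deriv (u t)) y + f (u t y)) x)) := by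
    intro t x
    have h := (((hut x).differentiable one_ne_zero t).hasDerivAt.pow 2).deriv
    have h' : deriv (fun s => u s x ^ 2) t = 2 * (u t x * deriv (fun s => u s x) t) :=
      h.trans (by simp; ring)
    rw [h', eq_neg_of_add_eq_zero_left (heq t x)]
    ring
  have hvirial : ∀ t, ∫ x, x * deriv (fun s => u s x ^ 2) t
      = -3 * (∫ x, deriv (u t) x ^ 2) + 2 * ∫ x, F (u t x) := by
    intro t
    have hL : Integrable
        (fun x => x * (u t x * deriv (fun y => deriv (deriv (u t)) y + f (u t y)) x)) := by
      refine ((hxdt t).const_mul (-1 / 2)).congr (Eventually.of_forall fun x => ?_)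
      simp only [hsq]
      ring
    have b5 : Tendsto (fun x => x * (u t x * f (u t x))) (cocompact ℝ) (𝓝 0) := by
      refine squeeze_zero_norm (a := fun x => 4 * (j + 1) * |x * G (u t x)|) (fun x => ?_) ?_
      · rw [Real.norm_eq_abs, abs_mul, abs_mul x]
        have := (hbounds _ ((hsup t x).trans_le (min_le_left _ _))).2.2
        calc |x| * |u t x * f (u t x)| ≤ |x| * (4 * (j + 1) * |G (u t x)|) := by gcongr
          _ = _ := by ring
      · simpa using (b3 t).abs.const_mul (4 * ((j : ℝ) + 1))
    simp only [hsq]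
    rw [integral_const_mul, integral_mul_deriv_gkdv_flux hfdiff hGderiv hFeq (hux t) hL
      (hdu2 t) (hFi t) (b1 t) (b2 t) (b3 t) (b4 t) b5]
    ring
  have hFbound : ∀ t, ∫ x, F (u t x) ≤ ∫ x, deriv (u t) x ^ 2 := by
    intro t
    have hle : ∀ x, F (u t x)
        ≤ 16 * ((∫ y, u t y ^ 2) * ∫ y, deriv (u t) y ^ 2) * u t x ^ 2 := by
      intro x
      obtain ⟨h1, h2, -⟩ := hbounds _ ((hsup t x).trans_le (min_le_left _ _))
      have hu : |u t x| ≤ 1 := ((hsup t x).trans_le (min_le_right _ _)).le.trans (by norm_num)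
      have hpow : |u t x| ^ (j + 1) ≤ u t x ^ 4 * u t x ^ 2 := by
        calc |u t x| ^ (j + 1) ≤ |u t x| ^ 6 :=
              pow_le_pow_of_le_one (abs_nonneg _) hu (by omega)
          _ = u t x ^ 4 * u t x ^ 2 := by rw [Even.pow_abs (by decide)]; ring
      have hgn := mul_le_mul_of_nonneg_right (pow_four_le_integral_sq_mul_integral_deriv_sq
        (hu1 t) (hu2 t) (hdu2 t) (hu0 t) x) (sq_nonneg (u t x))
      rw [hFeq]
      linarith [le_abs_self (u t x * f (u t x)), neg_abs_le (G (u t x))]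
    have hinteg := integral_mono (hFi t) ((hu2 t).const_mul _) hle
    rw [integral_const_mul] at hinteg
    have hA4 : ∫ y, u t y ^ 2 ≤ 1 / 4 := by
      have h1 : min δ (1 / 2) ^ 2 ≤ (1 / 2 : ℝ) ^ 2 := by
        gcongr
        exact min_le_right _ _
      linarith [hH1 t, hB t]
    refine hinteg.trans ?_
    have hAA : (∫ y, u t y ^ 2) * (∫ y, u t y ^ 2) ≤ 1 / 4 * (1 / 4) :=
      mul_le_mul hA4 hA4 (hA t) (by norm_num)
    nlinarith [mul_le_mul_of_nonneg_right hAA (hB t)]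
  have hIderiv : ∀ t, HasDerivAt (fun s => ∫ x, x * u s x ^ 2)
      (∫ x, x * deriv (fun s => u s x ^ 2) t) t := by
    intro t
    obtain ⟨g, hg, r, hr, hgb⟩ := hdom t
    refine (hasDerivAt_integral_of_dominated_loc_of_deriv_le
      (F := fun s x => x * u s x ^ 2) (F' := fun s x => x * deriv (fun s => u s x ^ 2) s)
      (Metric.ball_mem_nhds t hr)
      (Eventually.of_forall fun s => (hxu s).aestronglyMeasurable) (hxu t)
      (hxdt t).aestronglyMeasurable (Eventually.of_forall fun x s hs => ?_) hg
      (Eventually.of_forall fun x s _ => (hut' s x).const_mul x)).2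
    exact hgb s (by simpa [Real.dist_eq] using hs) x
  intro t x
  have hzero := deriv_eq_zero_of_periodic_of_nonpos hIderiv
    (fun t => by rw [hvirial]; linarith [hFbound t, hB t]) hω (fun t => by simp only [hper]) t
  rw [hvirial] at hzero
  have hB0 : ∫ y, deriv (u t) y ^ 2 = 0 := by linarith [hFbound t, hB t]
  have hgn := pow_four_le_integral_sq_mul_integral_deriv_sq (hu1 t) (hu2 t) (hdu2 t) (hu0 t) x
  rw [hB0, mul_zero] at hgn
  exact pow_eq_zero_iff (n := 4) (by norm_num) |>.1 (le_antisymm hgn (by positivity))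
end

section
/- Let u be a solution of the generalized KdV equation ∂ₜu + ∂ₓ(∂ₓ²u + f(u)) = 0 which is C¹ in t and C³ in x, and assume that for each t the functions x·u(t,·)², u(t,·)², (∂ₓu(t,·))², G(u(t,·)), F(u(t,·)) and x·∂ₜ(u²)(t,·) are integrable over ℝ, that u, ∂ₓu and the boundary terms x·u·∂ₓ²u, x·(∂ₓu)², x·G(u), u·∂ₓu vanish as |x| → ∞, and that x·∂ₜ(u²)(t,x) is dominated, locally uniformly in t, by an integrable function of x. Then for every t, d/dt ∫_ℝ x·u²(t,x) dx = −6 ( I₃(u(t,·)) + ∫_ℝ (G(u(t,x)) − F(u(t,x))/3) dx ), where G(s) = ∫₀^s f(r) dr, F is determined by F'(s) = s f'(s) with F(0) = 0, and I₃(v) = ∫_ℝ (½ v'(x)² − G(v(x))) dx. -/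
open MeasureTheory Filter Topology

/-- If `h` is integrable and `x * h x` converges at `+∞`, then the limit is zero. -/
theorem eq_zero_of_integrable_of_tendsto_mul_atTop {h : ℝ → ℝ} {L : ℝ} (hh : Integrable h)
    (hL : Tendsto (fun x => x * h x) atTop (𝓝 L)) : L = 0 := by
  by_contra hne
  have hev : ∀ᶠ x in atTop, |L| / 2 < |x * h x| :=
    hL.abs.eventually (lt_mem_nhds (half_lt_self (abs_pos.mpr hne)))
  obtain ⟨a, ha⟩ := eventually_atTop.mp (hev.and (eventually_gt_atTop (0 : ℝ)))
  have hLpos : 0 < |L| := abs_pos.mpr hne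
  refine not_integrableOn_Ioi_inv (a := a)
    (((hh.norm.const_mul (2 / |L|)).integrableOn (s := Set.Ioi a)).mono'
      measurable_inv.aestronglyMeasurable ?_)
  refine (ae_restrict_iff' measurableSet_Ioi).mpr (Eventually.of_forall fun x hx => ?_)
  obtain ⟨h1, h2⟩ := ha x (le_of_lt hx)
  rw [abs_mul, abs_of_pos h2] at h1
  rw [Real.norm_eq_abs, Real.norm_eq_abs, abs_of_pos (inv_pos.mpr h2), div_mul_eq_mul_div,
    inv_eq_one_div, div_le_div_iff₀ h2 hLpos]
  linarith

/-- If `h` is integrable and `x * h x` converges at `-∞`, then the limit is zero. -/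
theorem eq_zero_of_integrable_of_tendsto_mul_atBot {h : ℝ → ℝ} {L : ℝ} (hh : Integrable h)
    (hL : Tendsto (fun x => x * h x) atBot (𝓝 L)) : L = 0 := by
  refine neg_eq_zero.mp (eq_zero_of_integrable_of_tendsto_mul_atTop hh.comp_neg ?_)
  refine (hL.comp tendsto_neg_atTop_atBot).neg.congr fun x => ?_
  simp

/-- The integral of a derivative vanishes when the primitive is the sum of a function vanishing
at infinity and of `x * h x` with `h` integrable. -/
theorem integral_eq_zero_of_hasDerivAt_add_mul {A h w : ℝ → ℝ}
    (hd : ∀ x, HasDerivAt (fun y => A y + y * h y) (w x) x) (hw : Integrable w)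
    (hA : Tendsto A (cocompact ℝ) (𝓝 0)) (hh : Integrable h) : ∫ x, w x = 0 := by
  have htop := tendsto_limUnder_of_hasDerivAt_of_integrableOn_Ioi (a := 0)
    (fun x _ => hd x) hw.integrableOn
  have hbot := tendsto_limUnder_of_hasDerivAt_of_integrableOn_Iic (a := 0)
    (fun x _ => hd x) hw.integrableOn
  have htop0 := eq_zero_of_integrable_of_tendsto_mul_atTop hh
    ((htop.sub (hA.mono_left atTop_le_cocompact)).congr fun x => add_sub_cancel_left _ _)
  have hbot0 := eq_zero_of_integrable_of_tendsto_mul_atBot hh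
    ((hbot.sub (hA.mono_left atBot_le_cocompact)).congr fun x => add_sub_cancel_left _ _)
  rw [integral_of_hasDerivAt_of_tendsto hd hw hbot htop]
  linarith

/-- Virial identity for the generalized KdV equation:
`d/dt ∫ x·u²(t,x) dx = −6 ( I₃(u(t)) + ∫ (G(u) − F(u)/3) dx )`,
where G(s) = ∫₀^s f, F'(s) = s f'(s) with F(0) = 0, and
I₃(v) = ∫ (½ v'² − G(v)). -/
theorem gkdv_virial_x_u_sq
    (f : ℝ → ℝ) (hf : ContDiff ℝ 1 f)
    (G : ℝ → ℝ) (hG : ∀ s : ℝ, G s = ∫ r in (0:ℝ)..s, f r)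
    (F : ℝ → ℝ) (hF0 : F 0 = 0) (hF' : ∀ s : ℝ, HasDerivAt F (s * deriv f s) s)
    (u : ℝ → ℝ → ℝ)
    (hu_t : ∀ x, ContDiff ℝ 1 (fun t => u t x))
    (hu_x : ∀ t, ContDiff ℝ 3 (fun x => u t x))
    (heq : ∀ t x, deriv (fun s => u s x) t
        + deriv (fun y => deriv (deriv (u t)) y + f (u t y)) x = 0)
    (hint_xu2 : ∀ t, Integrable (fun x => x * (u t x) ^ 2))
    (hint_u2 : ∀ t, Integrable (fun x => (u t x) ^ 2))
    (hint_ux2 : ∀ t, Integrable (fun x => (deriv (u t) x) ^ 2))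
    (hint_Gu : ∀ t, Integrable (fun x => G (u t x)))
    (hint_Fu : ∀ t, Integrable (fun x => F (u t x)))
    (hint_xdtu2 : ∀ t, Integrable (fun x => x * deriv (fun s => (u s x) ^ 2) t))
    (hdec_u : ∀ t, Tendsto (u t) (cocompact ℝ) (𝓝 0))
    (hdec_ux : ∀ t, Tendsto (deriv (u t)) (cocompact ℝ) (𝓝 0))
    (hdec_xuuxx : ∀ t, Tendsto (fun x => x * u t x * deriv (deriv (u t)) x) (cocompact ℝ) (𝓝 0))
    (hdec_xux2 : ∀ t, Tendsto (fun x => x * (deriv (u t) x) ^ 2) (cocompact ℝ) (𝓝 0))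
    (hdec_xGu : ∀ t, Tendsto (fun x => x * G (u t x)) (cocompact ℝ) (𝓝 0))
    (hdec_uux : ∀ t, Tendsto (fun x => u t x * deriv (u t) x) (cocompact ℝ) (𝓝 0))
    (hdom : ∀ t₀ : ℝ, ∃ g : ℝ → ℝ, Integrable g ∧ ∃ δ > 0, ∀ t, |t - t₀| < δ →
        ∀ x, |x * deriv (fun s => (u s x) ^ 2) t| ≤ g x) :
    ∀ t, HasDerivAt (fun s => ∫ x, x * (u s x) ^ 2)
      (-6 * ((∫ x, ((1/2) * (deriv (u t) x) ^ 2 - G (u t x)))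
          + ∫ x, (G (u t x) - F (u t x) / 3))) t := by
  intro t
  obtain ⟨g, hg, δ, hδ, hgb⟩ := hdom t
  have hmain := (hasDerivAt_integral_of_dominated_loc_of_deriv_le
    (F := fun s x => x * (u s x) ^ 2) (F' := fun s x => x * deriv (fun r => (u r x) ^ 2) s)
    (μ := volume) (bound := g) (x₀ := t) (Metric.ball_mem_nhds t hδ)
    (Eventually.of_forall fun s => (hint_xu2 s).aestronglyMeasurable) (hint_xu2 t)
    (hint_xdtu2 t).aestronglyMeasurable
    (Eventually.of_forall fun x s hs => hgb s (by rwa [Metric.mem_ball, Real.dist_eq] at hs) x)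
    hg
    (Eventually.of_forall fun x s _ =>
      ((((hu_t x).differentiable one_ne_zero).pow 2 s).hasDerivAt.const_mul x))).2
  refine hmain.congr_deriv ?_
  have hu2 : ContDiff ℝ 2 (deriv (u t)) :=
    ((contDiff_succ_iff_deriv (n := 2)).mp ((hu_x t).of_le (by norm_num))).2.2
  have hu1 : ContDiff ℝ 1 (deriv (deriv (u t))) :=
    ((contDiff_succ_iff_deriv (n := 1)).mp (hu2.of_le (by norm_num))).2.2
  have hd0 : ∀ x, HasDerivAt (u t) (deriv (u t) x) x := fun x =>
    ((hu_x t).differentiable (by norm_num) x).hasDerivAt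
  have hd1 : ∀ x, HasDerivAt (deriv (u t)) (deriv (deriv (u t)) x) x := fun x =>
    (hu2.differentiable (by norm_num) x).hasDerivAt
  have hd2 : ∀ x, HasDerivAt (deriv (deriv (u t))) (deriv (deriv (deriv (u t))) x) x := fun x =>
    (hu1.differentiable one_ne_zero x).hasDerivAt
  have hdt : ∀ x, deriv (fun s => (u s x) ^ 2) t =
      2 * u t x * -(deriv (deriv (deriv (u t))) x + deriv f (u t x) * deriv (u t) x) := by
    intro x
    have hfu : HasDerivAt (fun y => f (u t y)) (deriv f (u t x) * deriv (u t) x) x :=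
      (hf.differentiable one_ne_zero (u t x)).hasDerivAt.comp x (hd0 x)
    have h1 := heq t x
    rw [((hd2 x).fun_add hfu).deriv] at h1
    rw [(((hu_t x).differentiable one_ne_zero t).hasDerivAt.fun_pow 2).deriv,
      eq_neg_of_add_eq_zero_left h1]
    norm_num
  have hzero : ∫ x, (x * deriv (fun s => (u s x) ^ 2) t + 3 * (deriv (u t) x) ^ 2
      - 2 * F (u t x)) = 0 := by
    refine integral_eq_zero_of_hasDerivAt_add_mul
      (A := fun x => -2 * (x * u t x * deriv (deriv (u t)) x) + x * (deriv (u t) x) ^ 2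
        + 2 * (u t x * deriv (u t) x)) (h := fun x => -2 * F (u t x)) (fun x => ?_)
      (((hint_xdtu2 t).add ((hint_ux2 t).const_mul 3)).sub ((hint_Fu t).const_mul 2)) ?_
      ((hint_Fu t).const_mul _)
    · have hFu : HasDerivAt (fun y => F (u t y))
          (u t x * deriv f (u t x) * deriv (u t) x) x := (hF' (u t x)).comp x (hd0 x)
      have hid := hasDerivAt_id' x
      have hsum := (((((hid.fun_mul (hd0 x)).fun_mul (hd2 x)).const_mul (-2)).fun_add
        (hid.fun_mul ((hd1 x).fun_pow 2))).fun_add (((hd0 x).fun_mul (hd1 x)).const_mul 2)).fun_add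
        (hid.fun_mul (hFu.const_mul (-2)))
      refine hsum.congr_deriv ?_
      rw [hdt x]
      norm_num
      ring
    · simpa using (((hdec_xuuxx t).const_mul (-2)).add (hdec_xux2 t)).add
        ((hdec_uux t).const_mul 2)
  rw [integral_sub (by exact (hint_xdtu2 t).add ((hint_ux2 t).const_mul 3))
      ((hint_Fu t).const_mul 2),
    integral_add (hint_xdtu2 t) ((hint_ux2 t).const_mul 3), integral_const_mul,
    integral_const_mul] at hzero
  rw [integral_sub ((hint_ux2 t).const_mul _) (hint_Gu t),
    integral_sub (hint_Gu t) ((hint_Fu t).div_const 3), integral_const_mul, integral_div]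
  linarith
end

section
/- Let u be a solution of the modified KdV equation ∂ₜu + ∂ₓ(∂ₓ²u + u³) = 0 which is C¹ in t and C³ in x, satisfying for each t: x·u(t,·)², u(t,·)², (∂ₓu(t,·))², u(t,·)⁴ and x·∂ₜ(u²)(t,·) integrable over ℝ; u, ∂ₓu and the boundary terms x·u·∂ₓ²u, x·(∂ₓu)², x·u⁴, u·∂ₓu vanishing as |x| → ∞; and x·∂ₜ(u²) dominated, locally uniformly in t, by an integrable function of x. Then (i) d/dt ∫_ℝ x·u²(t,x) dx = −6 I₃(u(t,·)) for every t, where I₃(v) = ∫_ℝ (½ v'(x)² − ¼ v(x)⁴) dx; in particular (ii) if u is periodic in time with some period ω > 0 and I₃ is constant along the solution, then I₃(u(t,·)) = 0 for all t. -/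
open MeasureTheory Filter Topology

/-- Pointwise virial identity for the modified KdV flow: the density `x ∂ₜ(u²)` is minus six times
the energy density, up to an exact spatial derivative. -/
lemma hasDerivAt_virial_flux {v : ℝ → ℝ} (hv : ContDiff ℝ 3 v) (x : ℝ) :
    HasDerivAt (fun y => -2 * (y * v y * deriv (deriv v) y) + 2 * (v y * deriv v y)
        + y * deriv v y ^ 2 - 3 / 2 * (y * v y ^ 4))
      (x * (2 * v x * -deriv (fun y => deriv (deriv v) y + v y ^ 3) x)
        + 6 * (1 / 2 * deriv v x ^ 2 - 1 / 4 * v x ^ 4)) x := by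
  have h1 : ContDiff ℝ 2 (deriv v) :=
    ((contDiff_succ_iff_deriv (n := 2)).1 (by norm_num; exact hv)).2.2
  have h2 : ContDiff ℝ 1 (deriv (deriv v)) :=
    ((contDiff_succ_iff_deriv (n := 1)).1 (by norm_num; exact h1)).2.2
  have d0 : HasDerivAt v (deriv v x) x := (hv.differentiable (by norm_num) x).hasDerivAt
  have d1 : HasDerivAt (deriv v) (deriv (deriv v) x) x :=
    (h1.differentiable (by norm_num) x).hasDerivAt
  have d2 : HasDerivAt (deriv (deriv v)) (deriv (deriv (deriv v)) x) x :=
    (h2.differentiable (by norm_num) x).hasDerivAt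
  have hflux : deriv (fun y => deriv (deriv v) y + v y ^ 3) x = _ := (d2.add (d0.pow 3)).deriv
  rw [hflux]
  have hx := hasDerivAt_id' x
  have key := ((((hx.mul d0).mul d2).const_mul (-2)).add ((d0.mul d1).const_mul 2)).add
    (hx.mul (d1.pow 2)) |>.sub ((hx.mul (d0.pow 4)).const_mul (3 / 2))
  refine key.congr_deriv ?_
  simp only [Pi.mul_apply, Pi.pow_apply]
  norm_num
  ring

/-- For the modified KdV equation, `d/dt ∫ x·u²(t,x) dx = −6 I₃(u(t))` where
`I₃(v) = ∫ (½ v'² − ¼ v⁴)`; in particular a time periodic solution along which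
`I₃` is constant must have `I₃(u(t)) = 0` for all `t`. -/
theorem mkdv_virial_x_u_sq_and_periodic_energy_zero
    (u : ℝ → ℝ → ℝ)
    (hu_t : ∀ x, ContDiff ℝ 1 (fun t => u t x))
    (hu_x : ∀ t, ContDiff ℝ 3 (fun x => u t x))
    (heq : ∀ t x, deriv (fun s => u s x) t
        + deriv (fun y => deriv (deriv (u t)) y + (u t y) ^ 3) x = 0)
    (hint_xu2 : ∀ t, Integrable (fun x => x * (u t x) ^ 2))
    (hint_u2 : ∀ t, Integrable (fun x => (u t x) ^ 2))
    (hint_ux2 : ∀ t, Integrable (fun x => (deriv (u t) x) ^ 2))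
    (hint_u4 : ∀ t, Integrable (fun x => (u t x) ^ 4))
    (hint_xdtu2 : ∀ t, Integrable (fun x => x * deriv (fun s => (u s x) ^ 2) t))
    (hdec_u : ∀ t, Tendsto (u t) (cocompact ℝ) (𝓝 0))
    (hdec_ux : ∀ t, Tendsto (deriv (u t)) (cocompact ℝ) (𝓝 0))
    (hdec_xuuxx : ∀ t, Tendsto (fun x => x * u t x * deriv (deriv (u t)) x) (cocompact ℝ) (𝓝 0))
    (hdec_xux2 : ∀ t, Tendsto (fun x => x * (deriv (u t) x) ^ 2) (cocompact ℝ) (𝓝 0))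
    (hdec_xu4 : ∀ t, Tendsto (fun x => x * (u t x) ^ 4) (cocompact ℝ) (𝓝 0))
    (hdec_uux : ∀ t, Tendsto (fun x => u t x * deriv (u t) x) (cocompact ℝ) (𝓝 0))
    (hdom : ∀ t₀ : ℝ, ∃ g : ℝ → ℝ, Integrable g ∧ ∃ δ > 0, ∀ t, |t - t₀| < δ →
        ∀ x, |x * deriv (fun s => (u s x) ^ 2) t| ≤ g x) :
    (∀ t, HasDerivAt (fun s => ∫ x, x * (u s x) ^ 2)
        (-6 * ∫ x, ((1/2) * (deriv (u t) x) ^ 2 - (1/4) * (u t x) ^ 4)) t)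
    ∧ (∀ ω > 0, (∀ t x, u (t + ω) x = u t x) →
        (∀ t t', (∫ x, ((1/2) * (deriv (u t) x) ^ 2 - (1/4) * (u t x) ^ 4))
            = ∫ x, ((1/2) * (deriv (u t') x) ^ 2 - (1/4) * (u t' x) ^ 4)) →
        ∀ t, (∫ x, ((1/2) * (deriv (u t) x) ^ 2 - (1/4) * (u t x) ^ 4)) = 0) := by
  have hdt : ∀ t x, HasDerivAt (fun s => x * u s x ^ 2)
      (x * deriv (fun s => u s x ^ 2) t) t := fun t x =>
    ((((hu_t x).pow 2).differentiable (by norm_num) t).hasDerivAt).const_mul x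
  have hdt_eq : ∀ t x, deriv (fun s => u s x ^ 2) t
      = 2 * u t x * -deriv (fun y => deriv (deriv (u t)) y + u t y ^ 3) x := by
    intro t x
    have h : deriv (fun s => u s x ^ 2) t = _ :=
      ((((hu_t x).differentiable (by norm_num) t).hasDerivAt).pow 2).deriv
    rw [h, ← eq_neg_of_add_eq_zero_left (heq t x)]
    norm_num
  have hE : ∀ t, Integrable (fun x => (1/2) * (deriv (u t) x) ^ 2 - (1/4) * (u t x) ^ 4) :=
    fun t => ((hint_ux2 t).const_mul _).sub ((hint_u4 t).const_mul _)
  have hvirial : ∀ t, ∫ x, x * deriv (fun s => u s x ^ 2) t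
      = -6 * ∫ x, ((1/2) * (deriv (u t) x) ^ 2 - (1/4) * (u t x) ^ 4) := by
    intro t
    have hlim : Tendsto (fun y => -2 * (y * u t y * deriv (deriv (u t)) y)
        + 2 * (u t y * deriv (u t) y) + y * deriv (u t) y ^ 2 - 3 / 2 * (y * u t y ^ 4))
        (cocompact ℝ) (𝓝 0) := by
      simpa using ((((hdec_xuuxx t).const_mul (-2)).add ((hdec_uux t).const_mul 2)).add
        (hdec_xux2 t)).sub ((hdec_xu4 t).const_mul (3 / 2))
    have hder := fun x => hasDerivAt_virial_flux (hu_x t) x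
    simp only [← hdt_eq] at hder
    have hint := integral_of_hasDerivAt_of_tendsto hder
      ((hint_xdtu2 t).add ((hE t).const_mul 6))
      (hlim.mono_left atBot_le_cocompact) (hlim.mono_left atTop_le_cocompact)
    rw [integral_add (hint_xdtu2 t) ((hE t).const_mul 6), integral_const_mul] at hint
    linarith
  have hmain : ∀ t, HasDerivAt (fun s => ∫ x, x * (u s x) ^ 2)
      (-6 * ∫ x, ((1/2) * (deriv (u t) x) ^ 2 - (1/4) * (u t x) ^ 4)) t := by
    intro t
    obtain ⟨g, hg, δ, hδ, hbound⟩ := hdom t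
    rw [← hvirial t]
    exact (hasDerivAt_integral_of_dominated_loc_of_deriv_le (Metric.ball_mem_nhds t hδ)
      (Eventually.of_forall fun s => (hint_xu2 s).aestronglyMeasurable) (hint_xu2 t)
      (hint_xdtu2 t).aestronglyMeasurable
      (Eventually.of_forall fun x s hs => hbound s (by simpa [Real.dist_eq] using hs) x)
      hg (Eventually.of_forall fun x s _ => hdt s x)).2
  refine ⟨hmain, fun ω hω hper hconst t => ?_⟩
  obtain ⟨c, -, hc⟩ := exists_hasDerivAt_eq_zero (lt_add_of_pos_right t hω)
    (fun s _ => (hmain s).continuousAt.continuousWithinAt) (by simp only [hper])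
    (fun s _ => hmain s)
  rw [hconst t c]
  linarith
end

section
/- For any α > 0 and β > 0, set δ = α² − 3β² and γ = 3α² − β², and define B(t,x) = 2√2 · ∂ₓ [ arctan( β sin(α(x + δt)) / (α cosh(β(x + γt))) ) ]. Then B is a smooth real-valued function on ℝ × ℝ and satisfies the modified KdV equation ∂ₜB + ∂ₓ(∂ₓ²B + B³) = 0 at every point (t,x) ∈ ℝ × ℝ. -/
/-- The function `(a cos ξ cosh η - b sin ξ sinh η) / (α² cosh² η + β² sin² ξ)` of the two
phases `ξ` and `η`. -/
noncomputable def breatherQuotient (α β a b ξ η : ℝ) : ℝ :=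
  (a * Real.cos ξ * Real.cosh η - b * Real.sin ξ * Real.sinh η) /
    (α ^ 2 * Real.cosh η ^ 2 + β ^ 2 * Real.sin ξ ^ 2)

lemma breatherDenom_pos {α : ℝ} (hα : 0 < α) (β ξ η : ℝ) :
    0 < α ^ 2 * Real.cosh η ^ 2 + β ^ 2 * Real.sin ξ ^ 2 := by
  have := Real.cosh_pos η
  positivity

lemma hasDerivAt_breatherNum {ξ η : ℝ → ℝ} {p q z : ℝ} (a b : ℝ)
    (hξ : HasDerivAt ξ p z) (hη : HasDerivAt η q z) :
    HasDerivAt (fun y => a * Real.cos (ξ y) * Real.cosh (η y)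
        - b * Real.sin (ξ y) * Real.sinh (η y))
      ((a * q - b * p) * Real.cos (ξ z) * Real.sinh (η z)
        - (a * p + b * q) * Real.sin (ξ z) * Real.cosh (η z)) z := by
  refine (((hξ.cos.const_mul a).mul hη.cosh).sub
    ((hξ.sin.const_mul b).mul hη.sinh)).congr_deriv ?_
  ring

lemma hasDerivAt_breatherDenom {ξ η : ℝ → ℝ} {p q z : ℝ} (α β : ℝ)
    (hξ : HasDerivAt ξ p z) (hη : HasDerivAt η q z) :
    HasDerivAt (fun y => α ^ 2 * Real.cosh (η y) ^ 2 + β ^ 2 * Real.sin (ξ y) ^ 2)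
      (2 * (α ^ 2 * q * Real.cosh (η z) * Real.sinh (η z)
        + β ^ 2 * p * Real.sin (ξ z) * Real.cos (ξ z))) z := by
  refine (((hη.cosh.pow 2).const_mul (α ^ 2)).add
    ((hξ.sin.pow 2).const_mul (β ^ 2))).congr_deriv ?_
  push_cast
  ring

lemma hasDerivAt_breatherQuotient {α : ℝ} (hα : 0 < α) {ξ η : ℝ → ℝ} {p q z : ℝ} (β a b : ℝ)
    (hξ : HasDerivAt ξ p z) (hη : HasDerivAt η q z) :
    HasDerivAt (fun y => breatherQuotient α β a b (ξ y) (η y))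
      ((((a * q - b * p) * Real.cos (ξ z) * Real.sinh (η z)
          - (a * p + b * q) * Real.sin (ξ z) * Real.cosh (η z))
        * (α ^ 2 * Real.cosh (η z) ^ 2 + β ^ 2 * Real.sin (ξ z) ^ 2)
        - (a * Real.cos (ξ z) * Real.cosh (η z) - b * Real.sin (ξ z) * Real.sinh (η z))
        * (2 * (α ^ 2 * q * Real.cosh (η z) * Real.sinh (η z)
          + β ^ 2 * p * Real.sin (ξ z) * Real.cos (ξ z))))
        / (α ^ 2 * Real.cosh (η z) ^ 2 + β ^ 2 * Real.sin (ξ z) ^ 2) ^ 2) z :=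
  (hasDerivAt_breatherNum a b hξ hη).div (hasDerivAt_breatherDenom α β hξ hη)
    (breatherDenom_pos hα β _ _).ne'

lemma hasDerivAt_arctan_breather {α : ℝ} (hα : 0 < α) {ξ η : ℝ → ℝ} {z : ℝ} (β : ℝ)
    (hξ : HasDerivAt ξ α z) (hη : HasDerivAt η β z) :
    HasDerivAt (fun y => Real.arctan (β * Real.sin (ξ y) / (α * Real.cosh (η y))))
      (α * β * breatherQuotient α β α β (ξ z) (η z)) z := by
  have hc := Real.cosh_pos (η z)
  have hD := breatherDenom_pos hα β (ξ z) (η z)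
  refine ((hξ.sin.const_mul β).div (hη.cosh.const_mul α) (by positivity)).arctan.congr_deriv ?_
  have hE : 1 + (β * Real.sin (ξ z) / (α * Real.cosh (η z))) ^ 2
      = (α ^ 2 * Real.cosh (η z) ^ 2 + β ^ 2 * Real.sin (ξ z) ^ 2)
        / (α * Real.cosh (η z)) ^ 2 := by
    field_simp
  simp only [Pi.div_apply]
  rw [hE, breatherQuotient]
  field_simp

/-- The second derivative of the breather profile, along phases with speeds `α` and `β`, completed
by the cubic term, is again a `breatherQuotient`. -/
lemma deriv_deriv_breatherQuotient_add_cube {α : ℝ} (hα : 0 < α) {ξ η : ℝ → ℝ} (β z : ℝ)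
    (hξ : ∀ y, HasDerivAt ξ α y) (hη : ∀ y, HasDerivAt η β y) :
    deriv (deriv fun y => breatherQuotient α β α β (ξ y) (η y)) z
        + 8 * (α * β) ^ 2 * breatherQuotient α β α β (ξ z) (η z) ^ 3
      = -breatherQuotient α β (α * (α ^ 2 - 3 * β ^ 2)) (β * (3 * α ^ 2 - β ^ 2)) (ξ z) (η z) := by
  have h₁ : (deriv fun y => breatherQuotient α β α β (ξ y) (η y)) = _ :=
    funext fun y => (hasDerivAt_breatherQuotient hα β α β (hξ y) (hη y)).deriv
  have hD := breatherDenom_pos hα β (ξ z) (η z)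
  have hN := hasDerivAt_breatherNum α β (hξ z) (hη z)
  have hD' := hasDerivAt_breatherDenom α β (hξ z) (hη z)
  have hs := (hξ z).sin
  have hc := (hξ z).cos
  have hS := (hη z).sinh
  have hC := (hη z).cosh
  have h₂ := (((((hc.const_mul (α * β - β * α)).mul hS).sub
    ((hs.const_mul (α * α + β * β)).mul hC)).mul hD').sub
    (hN.mul ((((hC.const_mul (α ^ 2 * β)).mul hS).add
      ((hs.const_mul (β ^ 2 * α)).mul hc)).const_mul 2))).div (hD'.pow 2) (pow_pos hD 2).ne'
  rw [h₁]
  erw [h₂.deriv]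
  have e₁ := Real.sin_sq_add_cos_sq (ξ z)
  have e₂ := Real.cosh_sq (η z)
  simp only [breatherQuotient, Pi.mul_apply, Pi.pow_apply, Pi.sub_apply, Pi.add_apply]
  generalize Real.sin (ξ z) = s at *
  generalize Real.cos (ξ z) = c at *
  generalize Real.cosh (η z) = C at *
  generalize Real.sinh (η z) = S at *
  field_simp
  grind

/-- The mKdV breather: for α, β > 0, δ = α² − 3β², γ = 3α² − β², the function
`B(t,x) = 2√2 ∂ₓ arctan(β sin(α(x+δt)) / (α cosh(β(x+γt))))` is smooth on ℝ × ℝ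
and solves the modified KdV equation `∂ₜB + ∂ₓ(∂ₓ²B + B³) = 0`. -/
theorem mkdv_breather_is_solution
    (α β : ℝ) (hα : 0 < α) (hβ : 0 < β)
    (δ γ : ℝ) (hδ : δ = α ^ 2 - 3 * β ^ 2) (hγ : γ = 3 * α ^ 2 - β ^ 2)
    (B : ℝ → ℝ → ℝ)
    (hB : ∀ t x, B t x = 2 * Real.sqrt 2 *
        deriv (fun y => Real.arctan
          (β * Real.sin (α * (y + δ * t)) / (α * Real.cosh (β * (y + γ * t))))) x) :
    ContDiff ℝ (⊤ : ℕ∞) (fun p : ℝ × ℝ => B p.1 p.2)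
    ∧ ∀ t x, deriv (fun s => B s x) t
        + deriv (fun y => deriv (deriv (B t)) y + (B t y) ^ 3) x = 0 := by
  have hx (a c y : ℝ) : HasDerivAt (fun y => a * (y + c)) a y := by
    simpa using ((hasDerivAt_id y).add_const c).const_mul a
  have ht (a c x s : ℝ) : HasDerivAt (fun s => a * (x + c * s)) (a * c) s := by
    simpa using (((hasDerivAt_id s).const_mul c).const_add x).const_mul a
  set κ := 2 * Real.sqrt 2 * (α * β) with hκ
  have hκ2 : κ ^ 2 = 8 * (α * β) ^ 2 := by
    rw [hκ, mul_pow, mul_pow, Real.sq_sqrt zero_le_two]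
    ring
  have hBq (t x : ℝ) :
      B t x = κ * breatherQuotient α β α β (α * (x + δ * t)) (β * (x + γ * t)) := by
    rw [hB, (hasDerivAt_arctan_breather hα β (hx α (δ * t) x) (hx β (γ * t) x)).deriv, hκ]
    ring
  refine ⟨?_, fun t x => ?_⟩
  · simp only [hBq, breatherQuotient]
    refine contDiff_const.mul (ContDiff.div ?_ ?_ fun p => (breatherDenom_pos hα β _ _).ne') <;>
      fun_prop
  · have hW (y : ℝ) : deriv (deriv (B t)) y + B t y ^ 3 =
        -κ * breatherQuotient α β (α * δ) (β * γ) (α * (y + δ * t)) (β * (y + γ * t)) := by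
      have hBt : B t = fun y => κ * breatherQuotient α β α β (α * (y + δ * t)) (β * (y + γ * t)) :=
        funext (hBq t)
      have key := deriv_deriv_breatherQuotient_add_cube hα β y (hx α (δ * t)) (hx β (γ * t))
      rw [← hδ, ← hγ, ← hκ2] at key
      rw [hBt]
      simp only [deriv_const_mul_field']
      linear_combination κ * key
    simp_rw [hW, hBq]
    rw [((hasDerivAt_breatherQuotient hα β α β (ht α δ x t) (ht β γ x t)).const_mul κ).deriv,
      ((hasDerivAt_breatherQuotient hα β (α * δ) (β * γ)
        (hx α (δ * t) x) (hx β (γ * t) x)).const_mul (-κ)).deriv]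
    have e₁ := Real.sin_sq_add_cos_sq (α * (x + δ * t))
    have e₂ := Real.cosh_sq (β * (x + γ * t))
    have hD := breatherDenom_pos hα β (α * (x + δ * t)) (β * (x + γ * t))
    generalize Real.sin (α * (x + δ * t)) = s at *
    generalize Real.cos (α * (x + δ * t)) = c at *
    generalize Real.cosh (β * (x + γ * t)) = C at *
    generalize Real.sinh (β * (x + γ * t)) = S at *
    rw [div_eq_mul_inv, div_eq_mul_inv]
    generalize ((α ^ 2 * C ^ 2 + β ^ 2 * s ^ 2) ^ 2)⁻¹ = I
    grind
end

section
/- Let μ > 0 and let α, β > 0 satisfy Δ := α² + β² − 2/(9μ) > 0. Set y₁ = x + δt with δ = α² − 3β², y₂ = x + γt with γ = 3α² − β², and define 𝒢(t,x) = (β√(α² + β²)/(α√Δ)) · sin(α y₁) − (√2 β (cosh(β y₂) + sinh(β y₂)))/(3√μ Δ) and 𝐹(t,x) = cosh(β y₂) − (√2 β (α cos(α y₁) − β sin(α y₁)))/(3√μ α √(α² + β²) √Δ). Then at every point (t,x) ∈ ℝ × ℝ where 𝐹(t,x) ≠ 0, the function B(t,x) = 2√(2/μ) · ∂ₓ [ arctan(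 𝒢(t,x)/𝐹(t,x) ) ] satisfies the Gardner equation ∂ₜB + ∂ₓ(∂ₓ²B + B² + μ B³) = 0. -/
open Filter Topology

/-- Combinations of one trigonometric and one hyperbolic travelling wave, with phases
`α (x + δ t)` and `β (x + γ t)`. This class is closed under differentiation. -/
noncomputable def trigHypWave (α β δ γ p q r s t x : ℝ) : ℝ :=
  p * Real.cos (α * (x + δ * t)) + q * Real.sin (α * (x + δ * t))
    + r * Real.cosh (β * (x + γ * t)) + s * Real.sinh (β * (x + γ * t))

lemma trigHypWave_hasDerivAt_space (α β δ γ p q r s t x : ℝ) :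
    HasDerivAt (fun y => trigHypWave α β δ γ p q r s t y)
      (trigHypWave α β δ γ (α * q) (-(α * p)) (β * s) (β * r) t x) x := by
  have h₁ : HasDerivAt (fun y => α * (y + δ * t)) α x := by
    simpa using ((hasDerivAt_id x).add_const (δ * t)).const_mul α
  have h₂ : HasDerivAt (fun y => β * (y + γ * t)) β x := by
    simpa using ((hasDerivAt_id x).add_const (γ * t)).const_mul β
  have h := (((h₁.cos.const_mul p).add (h₁.sin.const_mul q)).add (h₂.cosh.const_mul r)).add
    (h₂.sinh.const_mul s)
  refine h.congr_deriv ?_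
  simp only [trigHypWave]
  ring

lemma trigHypWave_hasDerivAt_time (α β δ γ p q r s t x : ℝ) :
    HasDerivAt (fun τ => trigHypWave α β δ γ p q r s τ x)
      (trigHypWave α β δ γ (α * δ * q) (-(α * δ * p)) (β * γ * s) (β * γ * r) t x) t := by
  have h₁ : HasDerivAt (fun τ => α * (x + δ * τ)) (α * δ) t := by
    simpa using (((hasDerivAt_id t).const_mul δ).const_add x).const_mul α
  have h₂ : HasDerivAt (fun τ => β * (x + γ * τ)) (β * γ) t := by
    simpa using (((hasDerivAt_id t).const_mul γ).const_add x).const_mul β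
  have h := (((h₁.cos.const_mul p).add (h₁.sin.const_mul q)).add (h₂.cosh.const_mul r)).add
    (h₂.sinh.const_mul s)
  refine h.congr_deriv ?_
  simp only [trigHypWave]
  ring

lemma hasDerivAt_arctan_div {f g : ℝ → ℝ} {f' g' x : ℝ} (hf : HasDerivAt f f' x)
    (hg : HasDerivAt g g' x) (h0 : f x ≠ 0) :
    HasDerivAt (fun y => Real.arctan (g y / f y))
      ((g' * f x - g x * f') / (f x ^ 2 + g x ^ 2)) x := by
  have hQ : f x ^ 2 + g x ^ 2 ≠ 0 := by positivity
  refine (hg.fun_div hf h0).arctan.congr_deriv ?_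
  have : 1 + (g x / f x) ^ 2 ≠ 0 := by positivity
  field_simp

/-- If `F` and `G` satisfy the two Hirota bilinear equations `hD3` and `hD2`, then
`c ∂ₓ arctan (G / F)` solves the Gardner equation where `F ≠ 0`. Subscripts of the hypotheses
record which partial derivatives the functions are. -/
lemma gardner_of_bilinear {μ c : ℝ} (hc : μ * c ^ 2 = 8)
    {F F₁ F₂ F₃ Fₜ Fₜ₁ G G₁ G₂ G₃ Gₜ Gₜ₁ B : ℝ → ℝ → ℝ}
    (hF : ∀ t x, HasDerivAt (F t) (F₁ t x) x) (hF₁ : ∀ t x, HasDerivAt (F₁ t) (F₂ t x) x)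
    (hF₂ : ∀ t x, HasDerivAt (F₂ t) (F₃ t x) x)
    (hFₜ : ∀ t x, HasDerivAt (fun s => F s x) (Fₜ t x) t)
    (hFₜ₁ : ∀ t x, HasDerivAt (Fₜ t) (Fₜ₁ t x) x)
    (hF₁ₜ : ∀ t x, HasDerivAt (fun s => F₁ s x) (Fₜ₁ t x) t)
    (hG : ∀ t x, HasDerivAt (G t) (G₁ t x) x) (hG₁ : ∀ t x, HasDerivAt (G₁ t) (G₂ t x) x)
    (hG₂ : ∀ t x, HasDerivAt (G₂ t) (G₃ t x) x)
    (hGₜ : ∀ t x, HasDerivAt (fun s => G s x) (Gₜ t x) t)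
    (hGₜ₁ : ∀ t x, HasDerivAt (Gₜ t) (Gₜ₁ t x) x)
    (hG₁ₜ : ∀ t x, HasDerivAt (fun s => G₁ s x) (Gₜ₁ t x) t)
    (hD3 : ∀ t x, Gₜ t x * F t x - G t x * Fₜ t x + G₃ t x * F t x - 3 * G₂ t x * F₁ t x
      + 3 * G₁ t x * F₂ t x - G t x * F₃ t x = 0)
    (hD2 : ∀ t x, 2 * (F t x * F₂ t x - F₁ t x ^ 2 + G t x * G₂ t x - G₁ t x ^ 2)
      = c / 3 * (G₁ t x * F t x - G t x * F₁ t x))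
    (hB : ∀ t x, B t x = c * deriv (fun y => Real.arctan (G t y / F t y)) x)
    (t x : ℝ) (h0 : F t x ≠ 0) :
    deriv (fun s => B s x) t
      + deriv (fun y => deriv (deriv (B t)) y + (B t y) ^ 2 + μ * (B t y) ^ 3) x = 0 := by
  have hBeq : ∀ s y, F s y ≠ 0 → B s y =
      c * ((G₁ s y * F s y - G s y * F₁ s y) / (F s y ^ 2 + G s y ^ 2)) := fun s y h => by
    rw [hB, (hasDerivAt_arctan_div (hF s y) (hG s y) h).deriv]
  have hspace : ∀ y, F t y ≠ 0 → ∀ᶠ z in 𝓝 y, F t z ≠ 0 := fun y h =>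
    (hF t y).continuousAt.eventually_ne h
  have hQ : ∀ s y, F s y ≠ 0 → F s y ^ 2 + G s y ^ 2 ≠ 0 := fun s y h => by positivity
  have hQx : ∀ y, HasDerivAt (fun z => F t z ^ 2 + G t z ^ 2)
      (2 * F t y * F₁ t y + 2 * G t y * G₁ t y) y := fun y =>
    (((hF t y).fun_pow 2).fun_add ((hG t y).fun_pow 2)).congr_deriv (by norm_num)
  have hN : ∀ y, HasDerivAt (fun z => G₁ t z * F t z - G t z * F₁ t z)
      (G₂ t y * F t y - G t y * F₂ t y) y := fun y =>
    (((hG₁ t y).fun_mul (hF t y)).fun_sub ((hG t y).fun_mul (hF₁ t y))).congr_deriv (by ring)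
  have hN₁ : ∀ y, HasDerivAt (fun z => G₂ t z * F t z - G t z * F₂ t z)
      (G₃ t y * F t y + G₂ t y * F₁ t y - G₁ t y * F₂ t y - G t y * F₃ t y) y := fun y =>
    (((hG₂ t y).fun_mul (hF t y)).fun_sub ((hG t y).fun_mul (hF₂ t y))).congr_deriv (by ring)
  have hB₁ : ∀ y, F t y ≠ 0 → deriv (B t) y =
      c * (((G₂ t y * F t y - G t y * F₂ t y) * (F t y ^ 2 + G t y ^ 2)
        - (G₁ t y * F t y - G t y * F₁ t y) * (2 * F t y * F₁ t y + 2 * G t y * G₁ t y))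
        / (F t y ^ 2 + G t y ^ 2) ^ 2) := fun y h => by
    have he : B t =ᶠ[𝓝 y] fun z =>
        c * ((G₁ t z * F t z - G t z * F₁ t z) / (F t z ^ 2 + G t z ^ 2)) :=
      (hspace y h).mono fun z hz => hBeq t z hz
    rw [he.deriv_eq, (((hN y).fun_div (hQx y) (hQ t y h)).const_mul c).deriv]
  have hpot : ∀ y, F t y ≠ 0 → deriv (deriv (B t)) y + (B t y) ^ 2 + μ * (B t y) ^ 3 =
      -c * ((Gₜ t y * F t y - G t y * Fₜ t y) / (F t y ^ 2 + G t y ^ 2)) := fun y h => by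
    have he : deriv (B t) =ᶠ[𝓝 y] _ := (hspace y h).mono fun z hz => hB₁ z hz
    have hnum := ((hN₁ y).fun_mul (hQx y)).fun_sub ((hN y).fun_mul
      ((((hF t y).const_mul 2).fun_mul (hF₁ t y)).fun_add
        (((hG t y).const_mul 2).fun_mul (hG₁ t y))))
    have hd := (hnum.fun_div ((hQx y).fun_pow 2) (pow_ne_zero 2 (hQ t y h))).const_mul c
    rw [he.deriv_eq, hd.deriv, hBeq t y h]
    have hq := hQ t y h
    have e₃ := hD3 t y
    have e₂ := hD2 t y
    generalize F t y = f, F₁ t y = f₁, F₂ t y = f₂, F₃ t y = f₃, G t y = g, G₁ t y = g₁,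
      G₂ t y = g₂, G₃ t y = g₃, Fₜ t y = fₜ, Gₜ t y = gₜ at *
    field_simp
    linear_combination c * (f ^ 2 + g ^ 2) ^ 3 * e₃
      - 3 * c * (f * g₁ - f₁ * g) * (f ^ 2 + g ^ 2) ^ 2 * e₂
      + c * (f ^ 2 + g ^ 2) * (f * g₁ - f₁ * g) ^ 3 * hc
  have he : (fun y => deriv (deriv (B t)) y + (B t y) ^ 2 + μ * (B t y) ^ 3) =ᶠ[𝓝 x] _ :=
    (hspace x h0).mono fun z hz => hpot z hz
  have ht : (fun s => B s x) =ᶠ[𝓝 t] _ :=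
    ((hFₜ t x).continuousAt.eventually_ne h0).mono fun s hs => hBeq s x hs
  have hdx := ((((hGₜ₁ t x).fun_mul (hF t x)).fun_sub ((hG t x).fun_mul (hFₜ₁ t x))).fun_div
    (hQx x) (hQ t x h0)).const_mul (-c)
  have hdt := ((((hG₁ₜ t x).fun_mul (hFₜ t x)).fun_sub ((hGₜ t x).fun_mul (hF₁ₜ t x))).fun_div
    (((hFₜ t x).fun_pow 2).fun_add ((hGₜ t x).fun_pow 2)) (hQ t x h0)).const_mul c
  rw [he.deriv_eq, ht.deriv_eq, hdx.deriv, hdt.deriv]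
  have hq := hQ t x h0
  field_simp
  ring

/-- The Gardner breather: for μ > 0, α, β > 0 with Δ = α² + β² − 2/(9μ) > 0,
the function `B = 2√(2/μ) ∂ₓ arctan(𝒢/𝐹)` solves the Gardner equation
`∂ₜB + ∂ₓ(∂ₓ²B + B² + μB³) = 0` at every point where `𝐹 ≠ 0`. -/
theorem gardner_breather_is_solution
    (μ α β : ℝ) (hμ : 0 < μ) (hα : 0 < α) (hβ : 0 < β)
    (Δ : ℝ) (hΔdef : Δ = α ^ 2 + β ^ 2 - 2 / (9 * μ)) (hΔ : 0 < Δ)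
    (δ γ : ℝ) (hδ : δ = α ^ 2 - 3 * β ^ 2) (hγ : γ = 3 * α ^ 2 - β ^ 2)
    (Gc Fc B : ℝ → ℝ → ℝ)
    (hGc : ∀ t x, Gc t x =
        (β * Real.sqrt (α ^ 2 + β ^ 2) / (α * Real.sqrt Δ)) * Real.sin (α * (x + δ * t))
        - Real.sqrt 2 * β * (Real.cosh (β * (x + γ * t)) + Real.sinh (β * (x + γ * t)))
            / (3 * Real.sqrt μ * Δ))
    (hFc : ∀ t x, Fc t x = Real.cosh (β * (x + γ * t))
        - Real.sqrt 2 * β * (α * Real.cos (α * (x + δ * t)) - β * Real.sin (α * (x + δ * t)))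
            / (3 * Real.sqrt μ * α * Real.sqrt (α ^ 2 + β ^ 2) * Real.sqrt Δ))
    (hB : ∀ t x, B t x = 2 * Real.sqrt (2 / μ) *
        deriv (fun y => Real.arctan (Gc t y / Fc t y)) x) :
    ∀ t x, Fc t x ≠ 0 →
      deriv (fun s => B s x) t
        + deriv (fun y => deriv (deriv (B t)) y + (B t y) ^ 2 + μ * (B t y) ^ 3) x = 0 := by
  obtain ⟨r, hr⟩ : ∃ r, r = Real.sqrt (α ^ 2 + β ^ 2) := ⟨_, rfl⟩
  obtain ⟨d, hd⟩ : ∃ d, d = Real.sqrt Δ := ⟨_, rfl⟩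
  obtain ⟨a, ha⟩ : ∃ a, a = Real.sqrt 2 / (3 * Real.sqrt μ) := ⟨_, rfl⟩
  have hsμ : Real.sqrt μ ^ 2 = μ := Real.sq_sqrt hμ.le
  have hs2 : Real.sqrt 2 ^ 2 = 2 := Real.sq_sqrt zero_le_two
  have hsμ0 : 0 < Real.sqrt μ := Real.sqrt_pos.2 hμ
  have hr0 : 0 < r := hr ▸ Real.sqrt_pos.2 (by positivity)
  have hd0 : 0 < d := hd ▸ Real.sqrt_pos.2 hΔ
  have hr2 : r ^ 2 = α ^ 2 + β ^ 2 := hr ▸ Real.sq_sqrt (by positivity)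
  have ha2 : a ^ 2 = 2 / (9 * μ) := by
    rw [ha, div_pow, mul_pow, hs2, hsμ]
    norm_num
  have hd2 : d ^ 2 = Δ := hd ▸ Real.sq_sqrt hΔ.le
  have hrel : a ^ 2 = α ^ 2 + β ^ 2 - d ^ 2 := by rw [hd2, hΔdef, ha2]; ring
  have hc : 2 * Real.sqrt (2 / μ) = 6 * a := by
    rw [ha, Real.sqrt_div zero_le_two]
    field_simp
    norm_num
  rw [hc] at hB
  have hc2 : μ * (6 * a) ^ 2 = 8 := by
    rw [mul_pow, ha2]
    field_simp
    norm_num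
  have hG : Gc = trigHypWave α β δ γ 0 (β * r / (α * d)) (-(a * β / d ^ 2)) (-(a * β / d ^ 2)) := by
    funext t x
    rw [hGc, trigHypWave, ← hr, ← hd, ← hd2, ha]
    field_simp
    ring
  have hF : Fc = trigHypWave α β δ γ (-(a * β / (r * d))) (a * β ^ 2 / (α * r * d)) 1 0 := by
    funext t x
    rw [hFc, trigHypWave, ← hr, ← hd, ha]
    field_simp
    ring
  have hx := trigHypWave_hasDerivAt_space α β δ γ
  have ht := trigHypWave_hasDerivAt_time α β δ γ
  rw [hG, hF] at hB
  rw [hF]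
  intro t x h0
  refine gardner_of_bilinear hc2 (hx _ _ _ _) (hx _ _ _ _) (hx _ _ _ _) (ht _ _ _ _)
    (hx _ _ _ _) (fun t x => (ht _ _ _ _ t x).congr_deriv ?_) (hx _ _ _ _) (hx _ _ _ _)
    (hx _ _ _ _) (ht _ _ _ _) (hx _ _ _ _) (fun t x => (ht _ _ _ _ t x).congr_deriv ?_)
    (fun t x => ?_) (fun t x => ?_) hB t x h0
  · congr 1 <;> ring
  · congr 1 <;> ring
  all_goals
    simp only [trigHypWave]
    have hC := Real.cos_sq_add_sin_sq (α * (x + δ * t))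
    have hH := Real.cosh_sq (β * (x + γ * t))
    generalize Real.cos (α * (x + δ * t)) = C, Real.sin (α * (x + δ * t)) = S,
      Real.cosh (β * (x + γ * t)) = Ch, Real.sinh (β * (x + γ * t)) = Sh at *
    subst hδ hγ
    clear hB hGc hFc h0 hG hF hx ht hc hc2 ha2 hd2
      ha hr hd hΔdef hsμ hs2 hsμ0
    simp only [mul_zero, zero_mul, mul_one, neg_zero, add_zero, zero_add]
    field_simp
  · grind
  · grind
end

section
/- Let f(s) = s² + f₂(s) with f₂ : ℝ → ℝ of class C² and f₂(s)/s² → 0 as s → 0, and λ(t) = t^{1/2}/log t. Let u be a solution of ∂ₜu + ∂ₓ(∂ₓ²u + f(u)) = 0, sufficiently regular (C¹ in t, C³ in x, with u(t,·), ∂ₓu(t,·) ∈ L² and the decay in x needed for the virial identities), with sup over t of ∫_ℝ |u(t,x)| dx < ∞ and sup over t of ‖u(t,·)‖_{H¹} < ε for ε > 0 sufficiently small. Then ∫₂^∞ λ(t)^{-1} ∫_ℝ sech⁴(x/λ(t)) (∂ₓu)²(t,x) dx dt < +∞, and there exists an increasing sequence of times sₙ → +∞ such that ∫_ℝ sech⁴(x/λ(sₙ))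 (∂ₓu)²(sₙ,x) dx → 0 as n → ∞. -/
open MeasureTheory Filter Topology

/-- The scaling function λ(t) = t^{1/2}/log t. -/
noncomputable def lam (t : ℝ) : ℝ := Real.sqrt t / Real.log t

lemma one_add_sq_div_two_le_cosh (y : ℝ) : 1 + y ^ 2 / 2 ≤ Real.cosh y := by
  have h : Real.cosh y = 1 + 2 * Real.sinh (y / 2) ^ 2 := by
    have h1 := Real.cosh_two_mul (y / 2)
    have h2 := Real.cosh_sq (y / 2)
    rw [mul_div_cancel₀ y two_ne_zero] at h1
    linarith
  have h2 : (y / 2) ^ 2 ≤ Real.sinh (y / 2) ^ 2 := by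
    refine sq_le_sq.mpr ?_
    rw [Real.abs_sinh]
    exact Real.self_le_sinh_iff.mpr (abs_nonneg _)
  rw [h]
  linarith

lemma sech_pos (y : ℝ) : 0 < (Real.cosh y)⁻¹ := inv_pos.mpr (Real.cosh_pos y)

lemma sech_le_one (y : ℝ) : (Real.cosh y)⁻¹ ≤ 1 := inv_le_one_of_one_le₀ (Real.one_le_cosh y)

lemma continuous_sech : Continuous fun y : ℝ => (Real.cosh y)⁻¹ :=
  Real.continuous_cosh.inv₀ fun y => (Real.cosh_pos y).ne'

lemma abs_mul_sech_le_one (y : ℝ) : |y| * (Real.cosh y)⁻¹ ≤ 1 := by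
  rw [← div_eq_mul_inv, div_le_one (Real.cosh_pos y)]
  have h := one_add_sq_div_two_le_cosh y
  nlinarith [sq_nonneg (|y| - 1), sq_abs y]

lemma sq_mul_sech_sq_le (y : ℝ) : y ^ 2 * (Real.cosh y)⁻¹ ^ 2 ≤ 4 * (1 + y ^ 2)⁻¹ := by
  have h := one_add_sq_div_two_le_cosh y
  have h2 : (1 + y ^ 2 / 2) ^ 2 ≤ Real.cosh y ^ 2 := by gcongr
  rw [inv_pow, ← div_eq_mul_inv, ← div_eq_mul_inv, div_le_div_iff₀ (by positivity) (by positivity)]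
  nlinarith [sq_nonneg y]

lemma tanh_sq_eq_one_sub_sech_sq (y : ℝ) : Real.tanh y ^ 2 = 1 - (Real.cosh y)⁻¹ ^ 2 := by
  have h := Real.cosh_sq y
  have h' := (Real.cosh_pos y).ne'
  rw [Real.tanh_eq_sinh_div_cosh]
  field_simp
  linarith

lemma abs_tanh_le_one (y : ℝ) : |Real.tanh y| ≤ 1 := by
  rw [← sq_le_one_iff_abs_le_one, tanh_sq_eq_one_sub_sech_sq]
  linarith [sq_nonneg (Real.cosh y)⁻¹]

lemma hasDerivAt_tanh (y : ℝ) : HasDerivAt Real.tanh ((Real.cosh y)⁻¹ ^ 2) y := by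
  have h' := (Real.cosh_pos y).ne'
  have h := (Real.hasDerivAt_sinh y).div (Real.hasDerivAt_cosh y) h'
  have e : Real.tanh = Real.sinh / Real.cosh := funext Real.tanh_eq_sinh_div_cosh
  rw [e]
  refine h.congr_deriv ?_
  field_simp
  linarith [Real.cosh_sq y]

lemma hasDerivAt_sech (y : ℝ) :
    HasDerivAt (fun y : ℝ => (Real.cosh y)⁻¹) (-(Real.tanh y * (Real.cosh y)⁻¹)) y := by
  have h' := (Real.cosh_pos y).ne'
  refine (Real.hasDerivAt_cosh y).inv h' |>.congr_deriv ?_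
  rw [Real.tanh_eq_sinh_div_cosh]
  field_simp

lemma deriv_tanh : deriv Real.tanh = fun y => (Real.cosh y)⁻¹ ^ 2 :=
  funext fun y => (hasDerivAt_tanh y).deriv

lemma deriv_deriv_tanh :
    deriv (deriv Real.tanh) = fun y => -2 * Real.tanh y * (Real.cosh y)⁻¹ ^ 2 := by
  rw [deriv_tanh]
  funext y
  rw [((hasDerivAt_sech y).fun_pow 2).deriv]
  norm_num
  ring

lemma deriv_deriv_deriv_tanh : deriv (deriv (deriv Real.tanh)) =
    fun y => (Real.cosh y)⁻¹ ^ 2 * (4 - 6 * (Real.cosh y)⁻¹ ^ 2) := by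
  rw [deriv_deriv_tanh]
  funext y
  rw [(((hasDerivAt_tanh y).const_mul (-2)).fun_mul ((hasDerivAt_sech y).fun_pow 2)).deriv]
  have h := tanh_sq_eq_one_sub_sech_sq y
  norm_num only [Nat.cast_ofNat, pow_one]
  linear_combination 4 * (Real.cosh y)⁻¹ ^ 2 * h

lemma contDiff_tanh {n : WithTop ℕ∞} : ContDiff ℝ n Real.tanh := by
  rw [show Real.tanh = fun y => Real.sinh y / Real.cosh y from funext Real.tanh_eq_sinh_div_cosh]
  exact Real.contDiff_sinh.div Real.contDiff_cosh fun y => (Real.cosh_pos y).ne'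

/-- The primitive `tanh - tanh³ / 3` of `sech⁴`. -/
noncomputable def sechFourPrimitive (y : ℝ) : ℝ := Real.tanh y - Real.tanh y ^ 3 / 3

lemma contDiff_sechFourPrimitive {n : WithTop ℕ∞} : ContDiff ℝ n sechFourPrimitive :=
  contDiff_tanh.sub ((contDiff_tanh.pow 3).div_const 3)

lemma deriv_sechFourPrimitive : deriv sechFourPrimitive = fun y => (Real.cosh y)⁻¹ ^ 4 := by
  funext y
  have h := (hasDerivAt_tanh y).fun_sub (((hasDerivAt_tanh y).fun_pow 3).div_const 3)
  have h2 := tanh_sq_eq_one_sub_sech_sq y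
  refine h.deriv.trans ?_
  norm_num only [Nat.cast_ofNat]
  linear_combination - (Real.cosh y)⁻¹ ^ 2 * h2

lemma deriv_deriv_sechFourPrimitive :
    deriv (deriv sechFourPrimitive) = fun y => -4 * Real.tanh y * (Real.cosh y)⁻¹ ^ 4 := by
  rw [deriv_sechFourPrimitive]
  funext y
  rw [((hasDerivAt_sech y).fun_pow 4).deriv]
  norm_num
  ring

lemma deriv_deriv_deriv_sechFourPrimitive : deriv (deriv (deriv sechFourPrimitive)) =
    fun y => (Real.cosh y)⁻¹ ^ 4 * (16 - 20 * (Real.cosh y)⁻¹ ^ 2) := by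
  rw [deriv_deriv_sechFourPrimitive]
  funext y
  rw [(((hasDerivAt_tanh y).const_mul (-4)).fun_mul ((hasDerivAt_sech y).fun_pow 4)).deriv]
  have h := tanh_sq_eq_one_sub_sech_sq y
  norm_num only [Nat.cast_ofNat]
  linear_combination 16 * (Real.cosh y)⁻¹ ^ 4 * h

lemma abs_sechFourPrimitive_le_two (y : ℝ) : |sechFourPrimitive y| ≤ 2 := by
  have h := abs_tanh_le_one y
  have h3 : |Real.tanh y ^ 3| ≤ 1 := by
    rw [abs_pow]
    exact pow_le_one₀ (abs_nonneg _) h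
  rw [sechFourPrimitive, abs_le]
  rw [abs_le] at h h3
  constructor <;> linarith

lemma abs_sech_pow_le_one (n : ℕ) (y : ℝ) : |(Real.cosh y)⁻¹ ^ n| ≤ 1 := by
  rw [abs_of_nonneg (pow_nonneg (sech_pos y).le n)]
  exact pow_le_one₀ (sech_pos y).le (sech_le_one y)

lemma abs_sech_sq_mul_le (y : ℝ) :
    |(Real.cosh y)⁻¹ ^ 2 * (4 - 6 * (Real.cosh y)⁻¹ ^ 2)| ≤ 4 := by
  have h := abs_sech_pow_le_one 2 y
  have h0 := sq_nonneg (Real.cosh y)⁻¹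
  rw [abs_le] at h ⊢
  constructor <;> nlinarith

lemma abs_sech_pow_four_mul_le (y : ℝ) :
    |(Real.cosh y)⁻¹ ^ 4 * (16 - 20 * (Real.cosh y)⁻¹ ^ 2)| ≤ 16 * (Real.cosh y)⁻¹ ^ 2 := by
  have h := abs_sech_pow_le_one 2 y
  have h0 := sq_nonneg (Real.cosh y)⁻¹
  have e : (Real.cosh y)⁻¹ ^ 4 = ((Real.cosh y)⁻¹ ^ 2) ^ 2 := by ring
  rw [e]
  rw [abs_le] at h
  generalize (Real.cosh y)⁻¹ ^ 2 = s at *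
  have h4 : s ^ 2 ≤ s := by nlinarith
  rw [abs_le]
  constructor <;> nlinarith

lemma exists_bound_iteratedDeriv_tanh :
    ∃ M : ℝ, ∀ n ≤ 3, ∀ x, |iteratedDeriv n Real.tanh x| ≤ M := by
  refine ⟨4, fun n hn x => ?_⟩
  have h1 := abs_tanh_le_one x
  have h2 := abs_sech_pow_le_one 2 x
  have h3 := abs_sech_sq_mul_le x
  interval_cases n <;> simp only [iteratedDeriv_succ, iteratedDeriv_zero, deriv_deriv_tanh]
  · linarith
  · rw [deriv_tanh]
    linarith
  · rw [abs_mul, abs_mul]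
    norm_num only [abs_neg, abs_two]
    nlinarith [abs_nonneg (Real.tanh x), abs_nonneg ((Real.cosh x)⁻¹ ^ 2)]
  · rw [← deriv_deriv_tanh, deriv_deriv_deriv_tanh]
    exact h3

lemma exists_bound_iteratedDeriv_sechFourPrimitive :
    ∃ M : ℝ, ∀ n ≤ 3, ∀ x, |iteratedDeriv n sechFourPrimitive x| ≤ M := by
  refine ⟨16, fun n hn x => ?_⟩
  have h0 := abs_sechFourPrimitive_le_two x
  have h1 := abs_tanh_le_one x
  have h2 := abs_sech_pow_le_one 4 x
  have h3 := abs_sech_pow_four_mul_le x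
  have h4 := (abs_le.mp (abs_sech_pow_le_one 2 x)).2
  interval_cases n <;> simp only [iteratedDeriv_succ, iteratedDeriv_zero,
    deriv_deriv_sechFourPrimitive]
  · linarith
  · rw [deriv_sechFourPrimitive]
    linarith
  · rw [abs_mul, abs_mul]
    norm_num only [abs_neg, Nat.abs_ofNat]
    nlinarith [abs_nonneg (Real.tanh x), abs_nonneg ((Real.cosh x)⁻¹ ^ 4)]
  · rw [← deriv_deriv_sechFourPrimitive, deriv_deriv_deriv_sechFourPrimitive]
    linarith

lemma sq_le_integral_sq_add_deriv_sq {v : ℝ → ℝ} (hv : ContDiff ℝ 1 v)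
    (h0 : Integrable fun x => v x ^ 2) (h1 : Integrable fun x => deriv v x ^ 2) (x : ℝ) :
    v x ^ 2 ≤ ∫ y, (v y ^ 2 + deriv v y ^ 2) := by
  have hc : Continuous v := hv.continuous
  have hc' : Continuous (deriv v) := hv.continuous_deriv le_rfl
  have hd : ∀ y ∈ Set.Iic x, HasDerivAt (fun y => v y ^ 2) (2 * v y * deriv v y) y := fun y _ => by
    simpa using ((hv.differentiable one_ne_zero y).hasDerivAt).fun_pow 2
  have hb : ∀ y, |2 * v y * deriv v y| ≤ v y ^ 2 + deriv v y ^ 2 := fun y =>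
    abs_le.mpr ⟨by linarith [sq_nonneg (v y + deriv v y)], by linarith [sq_nonneg (v y - deriv v y)]⟩
  have hi : Integrable fun y => 2 * v y * deriv v y :=
    (h0.add h1).mono' (by fun_prop) (ae_of_all _ hb)
  have ht := tendsto_zero_of_hasDerivAt_of_integrableOn_Iic hd hi.integrableOn h0.integrableOn
  have h := integral_Iic_of_hasDerivAt_of_tendsto' hd hi.integrableOn ht
  rw [sub_zero] at h
  rw [← h]
  calc ∫ y in Set.Iic x, 2 * v y * deriv v y
      ≤ ∫ y in Set.Iic x, (v y ^ 2 + deriv v y ^ 2) :=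
        setIntegral_mono hi.integrableOn (h0.add h1).integrableOn fun y => (abs_le.mp (hb y)).2
    _ ≤ ∫ y, (v y ^ 2 + deriv v y ^ 2) :=
        setIntegral_le_integral (h0.add h1) (ae_of_all _ fun y => by positivity)

lemma integrable_sech_pow_mul {w : ℝ → ℝ} (hw : Integrable w) (n : ℕ) (l : ℝ) :
    Integrable fun x => (Real.cosh (x / l))⁻¹ ^ n * w x := by
  refine hw.bdd_mul (c := 1) ?_ (ae_of_all _ fun x => abs_sech_pow_le_one n _)
  exact ((continuous_sech.comp (continuous_id.div_const l)).pow n).aestronglyMeasurable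

lemma le_virial_of_mass {v g : ℝ → ℝ} {l c τ M : ℝ} (h1 : Integrable v)
    (h2 : Integrable fun x => v x ^ 2) (hM : ∫ x, |v x| ≤ M) (hg : Continuous g)
    (hgv : ∀ x, |g x| ≤ v x ^ 2 / 2) (hl : 0 < l) (hc : |c| ≤ τ) :
    3 / 8 * (1 / l * ∫ x, (Real.cosh (x / l))⁻¹ ^ 2 * v x ^ 2)
        - 8 * Real.pi * τ ^ 2 * l ^ 2 - 4 * M * (1 / l ^ 3)
      ≤ -c * (∫ x, x / l * (Real.cosh (x / l))⁻¹ ^ 2 * v x)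
        + 1 / l ^ 3 * (∫ x, (Real.cosh (x / l))⁻¹ ^ 2 * (4 - 6 * (Real.cosh (x / l))⁻¹ ^ 2) * v x)
        + 1 / l * ∫ x, (Real.cosh (x / l))⁻¹ ^ 2 * (v x ^ 2 + g x) := by
  have hS := integrable_sech_pow_mul h2 2 l
  have hgi : Integrable g :=
    (h2.div_const 2).mono' hg.aestronglyMeasurable (ae_of_all _ hgv)
  have hτ : 0 ≤ τ := (abs_nonneg c).trans hc
  have hI : Integrable fun x : ℝ => (1 + (x / l) ^ 2)⁻¹ := integrable_inv_one_add_sq.comp_div hl.ne'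
  have hIe : ∫ x : ℝ, (1 + (x / l) ^ 2)⁻¹ = l * Real.pi := by
    rw [Measure.integral_comp_div (fun x : ℝ => (1 + x ^ 2)⁻¹), integral_univ_inv_one_add_sq,
      abs_of_pos hl, smul_eq_mul]
  have t1 : c * (∫ x, x / l * (Real.cosh (x / l))⁻¹ ^ 2 * v x)
      ≤ 1 / 8 * (1 / l * ∫ x, (Real.cosh (x / l))⁻¹ ^ 2 * v x ^ 2)
        + 8 * Real.pi * τ ^ 2 * l ^ 2 := by
    have hb : ∀ x, ‖c * (x / l * (Real.cosh (x / l))⁻¹ ^ 2 * v x)‖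
        ≤ 1 / (8 * l) * ((Real.cosh (x / l))⁻¹ ^ 2 * v x ^ 2)
          + 8 * l * τ ^ 2 * (1 + (x / l) ^ 2)⁻¹ := fun x => by
      have hy := sq_mul_sech_sq_le (x / l)
      have hs := sq_nonneg (Real.cosh (x / l))⁻¹
      generalize (1 + (x / l) ^ 2)⁻¹ = q at *
      generalize (Real.cosh (x / l))⁻¹ ^ 2 = s at *
      generalize x / l = y at *
      rw [Real.norm_eq_abs, abs_mul, abs_mul, abs_mul, abs_of_nonneg hs]
      have a1 : |c| * (|y| * s * |v x|) ≤ τ * (|y| * s * |v x|) := by gcongr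
      have a2 : τ * |y| * |v x| ≤ 1 / (8 * l) * v x ^ 2 + 2 * l * τ ^ 2 * y ^ 2 := by
        have e : 1 / (8 * l) * v x ^ 2 + 2 * l * τ ^ 2 * y ^ 2 - τ * |y| * |v x|
            = 1 / (8 * l) * (|v x| - 4 * l * (τ * |y|)) ^ 2 := by
          rw [← sq_abs (v x), ← sq_abs y]
          field_simp
          ring
        have : 0 ≤ 1 / (8 * l) * (|v x| - 4 * l * (τ * |y|)) ^ 2 := by positivity
        linarith
      have a3 := mul_le_mul_of_nonneg_right a2 hs
      have a4 : 2 * l * τ ^ 2 * (y ^ 2 * s) ≤ 2 * l * τ ^ 2 * (4 * q) := by gcongr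
      linarith
    rw [← integral_const_mul]
    refine (le_abs_self _).trans ((norm_integral_le_of_norm_le ((hS.const_mul _).add
      (hI.const_mul _)) (ae_of_all _ hb)).trans_eq ?_)
    rw [integral_add' (hS.const_mul _) (hI.const_mul _), integral_const_mul, integral_const_mul, hIe]
    field_simp
  have t2 : -(4 * M) ≤
      ∫ x, (Real.cosh (x / l))⁻¹ ^ 2 * (4 - 6 * (Real.cosh (x / l))⁻¹ ^ 2) * v x := by
    refine neg_le_of_abs_le ?_
    rw [← Real.norm_eq_abs]
    refine (norm_integral_le_of_norm_le (h1.abs.const_mul 4) (ae_of_all _ fun x => ?_)).trans ?_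
    · rw [norm_mul]
      exact mul_le_mul_of_nonneg_right (abs_sech_sq_mul_le _) (abs_nonneg _)
    · rw [integral_const_mul]
      linarith
  have t3 : 1 / 2 * ∫ x, (Real.cosh (x / l))⁻¹ ^ 2 * v x ^ 2
      ≤ ∫ x, (Real.cosh (x / l))⁻¹ ^ 2 * (v x ^ 2 + g x) := by
    rw [← integral_const_mul]
    refine integral_mono (hS.const_mul _) (integrable_sech_pow_mul (h2.add hgi) 2 l) fun x => ?_
    have := (abs_le.mp (hgv x)).1
    have hs := sq_nonneg (Real.cosh (x / l))⁻¹
    have := mul_le_mul_of_nonneg_left this hs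
    simp only
    linarith
  have t2' := mul_le_mul_of_nonneg_left t2 (show 0 ≤ 1 / l ^ 3 by positivity)
  have t3' := mul_le_mul_of_nonneg_left t3 (show 0 ≤ 1 / l by positivity)
  linarith

lemma virial_of_energy_le {v h : ℝ → ℝ} {l c D : ℝ} (h2 : Integrable fun x => v x ^ 2)
    (hh : ∀ x, |h x| ≤ 2 * v x ^ 2) (hl : 1 / l ≤ 2) (hl0 : 0 < l) (hc : |c| ≤ 1 / l) :
    -c * (∫ x, x / l * (Real.cosh (x / l))⁻¹ ^ 4 * v x ^ 2) - D
        + 1 / (2 * l ^ 3) * (∫ x,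
          (Real.cosh (x / l))⁻¹ ^ 4 * (16 - 20 * (Real.cosh (x / l))⁻¹ ^ 2) * v x ^ 2)
        + 1 / l * (∫ x, (Real.cosh (x / l))⁻¹ ^ 4 * h x)
      ≤ -D + 35 * (1 / l * ∫ x, (Real.cosh (x / l))⁻¹ ^ 2 * v x ^ 2) := by
  have hS := integrable_sech_pow_mul h2 2 l
  have key : ∀ (w : ℝ → ℝ) (K : ℝ), (∀ x, |w x| ≤ K * ((Real.cosh (x / l))⁻¹ ^ 2 * v x ^ 2)) →
      |∫ x, w x| ≤ K * ∫ x, (Real.cosh (x / l))⁻¹ ^ 2 * v x ^ 2 := fun w K hw => by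
    rw [← integral_const_mul, ← Real.norm_eq_abs]
    exact norm_integral_le_of_norm_le (hS.const_mul K) (ae_of_all _ hw)
  have hA : 0 ≤ ∫ x, (Real.cosh (x / l))⁻¹ ^ 2 * v x ^ 2 :=
    integral_nonneg fun x => by positivity
  have k1 := key (fun x => x / l * (Real.cosh (x / l))⁻¹ ^ 4 * v x ^ 2) 1 fun x => by
    have a := abs_mul_sech_le_one (x / l)
    have a' := sech_le_one (x / l)
    have a0 := sech_pos (x / l)
    rw [abs_mul, abs_mul, abs_of_nonneg (sq_nonneg (v x)), abs_of_nonneg (pow_nonneg a0.le 4)]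
    calc |x / l| * (Real.cosh (x / l))⁻¹ ^ 4 * v x ^ 2
        = (|x / l| * (Real.cosh (x / l))⁻¹) * (Real.cosh (x / l))⁻¹
          * ((Real.cosh (x / l))⁻¹ ^ 2 * v x ^ 2) := by ring
      _ ≤ 1 * 1 * ((Real.cosh (x / l))⁻¹ ^ 2 * v x ^ 2) := by gcongr
      _ = _ := by ring
  have k2 := key (fun x =>
      (Real.cosh (x / l))⁻¹ ^ 4 * (16 - 20 * (Real.cosh (x / l))⁻¹ ^ 2) * v x ^ 2) 16 fun x => by
    rw [abs_mul, abs_of_nonneg (sq_nonneg (v x)), ← mul_assoc]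
    exact mul_le_mul_of_nonneg_right (abs_sech_pow_four_mul_le _) (sq_nonneg _)
  have k3 := key (fun x => (Real.cosh (x / l))⁻¹ ^ 4 * h x) 2 fun x => by
    have a := abs_sech_pow_le_one 2 (x / l)
    have a0 := sech_pos (x / l)
    rw [abs_of_nonneg (by positivity)] at a
    rw [abs_mul, abs_of_nonneg (pow_nonneg a0.le 4)]
    calc (Real.cosh (x / l))⁻¹ ^ 4 * |h x|
        ≤ (Real.cosh (x / l))⁻¹ ^ 4 * (2 * v x ^ 2) := by gcongr; exact hh x
      _ = (Real.cosh (x / l))⁻¹ ^ 2 * (2 * ((Real.cosh (x / l))⁻¹ ^ 2 * v x ^ 2)) := by ring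
      _ ≤ 1 * (2 * ((Real.cosh (x / l))⁻¹ ^ 2 * v x ^ 2)) := by gcongr
      _ = _ := by ring
  generalize (∫ x, (Real.cosh (x / l))⁻¹ ^ 2 * v x ^ 2) = A at *
  have hl1 : 0 < 1 / l := by positivity
  have e : 1 / (2 * l ^ 3) = 1 / 2 * (1 / l) ^ 3 := by field_simp
  rw [e]
  generalize 1 / l = r at *
  have j1 : -c * (∫ x, x / l * (Real.cosh (x / l))⁻¹ ^ 4 * v x ^ 2) ≤ r * A := by
    refine (le_abs_self _).trans ?_
    rw [abs_mul, abs_neg]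
    exact mul_le_mul hc (by linarith) (abs_nonneg _) hl1.le
  have j2 := mul_le_mul_of_nonneg_left (le_of_abs_le k2) (show 0 ≤ 1 / 2 * r ^ 3 by positivity)
  have j3 := mul_le_mul_of_nonneg_left (le_of_abs_le k3) hl1.le
  have j4 : r ^ 3 * A ≤ 4 * r * A := by
    have : r ^ 2 ≤ 4 := by nlinarith
    have : r * r ^ 2 ≤ r * 4 := by gcongr
    exact mul_le_mul_of_nonneg_right (by linarith) hA
  linarith

lemma one_le_log {t : ℝ} (ht : 3 ≤ t) : 1 ≤ Real.log t :=
  (Real.le_log_iff_exp_le (by linarith)).mpr (Real.exp_one_lt_three.le.trans ht)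

lemma lam_pos {t : ℝ} (ht : 1 < t) : 0 < lam t :=
  div_pos (Real.sqrt_pos.mpr (by linarith)) (Real.log_pos ht)

lemma one_div_lam_le_two {t : ℝ} (ht : 1 < t) : 1 / lam t ≤ 2 := by
  have hs : 0 < √t := Real.sqrt_pos.mpr (by linarith)
  have h := Real.log_le_sub_one_of_pos hs
  rw [Real.log_sqrt (by linarith)] at h
  rw [lam, one_div_div, div_le_iff₀ hs]
  linarith

lemma one_div_le_one_div_lam {t : ℝ} (ht : 3 ≤ t) : 1 / t ≤ 1 / lam t := by
  refine one_div_le_one_div_of_le (lam_pos (by linarith)) ?_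
  have h := one_le_log ht
  rw [lam, div_le_iff₀ (by linarith)]
  have h1 : √t ≤ t := Real.sqrt_le_iff.mpr ⟨by linarith, by nlinarith⟩
  nlinarith

lemma abs_deriv_lam_div_lam_le {t : ℝ} (ht : 3 ≤ t) : |deriv lam t / lam t| ≤ 1 / t := by
  have h := one_le_log ht
  have ht0 : 0 < t := by linarith
  have hs : 0 < √t := Real.sqrt_pos.mpr ht0
  have hd := ((Real.hasDerivAt_sqrt ht0.ne').fun_div (Real.hasDerivAt_log ht0.ne')
    (by positivity)).deriv
  have e : deriv lam t / lam t = (Real.log t - 2) / (2 * Real.log t) * (1 / t) := by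
    rw [show deriv lam t = _ from hd, lam]
    have := Real.sq_sqrt ht0.le
    field_simp
    rw [this]
    ring
  rw [e, abs_mul, abs_of_pos (by positivity : 0 < 1 / t)]
  refine mul_le_of_le_one_left (by positivity) ?_
  rw [abs_div, abs_of_pos (by linarith : 0 < 2 * Real.log t), div_le_one (by linarith), abs_le]
  constructor <;> linarith

lemma one_div_lam_pow_three_le {t : ℝ} (ht : 3 ≤ t) :
    1 / lam t ^ 3 ≤ 1728 * t ^ (-(5 / 4) : ℝ) := by
  have h := one_le_log ht
  have ht0 : 0 < t := by linarith
  have hlog : Real.log t ≤ 12 * t ^ (1 / 12 : ℝ) := by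
    have := Real.log_le_rpow_div ht0.le (by norm_num : (0 : ℝ) < 1 / 12)
    linarith
  have hs : 0 < √t := Real.sqrt_pos.mpr ht0
  have e1 : √t ^ 3 = t ^ (3 / 2 : ℝ) := by
    rw [Real.sqrt_eq_rpow, ← Real.rpow_natCast, ← Real.rpow_mul ht0.le]
    norm_num
  have e2 : (12 * t ^ (1 / 12 : ℝ)) ^ 3 = 1728 * t ^ (1 / 4 : ℝ) := by
    rw [mul_pow, ← Real.rpow_natCast (t ^ (1 / 12 : ℝ)), ← Real.rpow_mul ht0.le]
    norm_num
  have e3 : t ^ (1 / 4 : ℝ) = t ^ (-(5 / 4) : ℝ) * t ^ (3 / 2 : ℝ) := by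
    rw [← Real.rpow_add ht0]
    norm_num
  rw [lam, div_pow, one_div_div, div_le_iff₀ (by positivity), e1, mul_assoc, ← e3, ← e2]
  gcongr

lemma hasDerivAt_neg_inv_log {t : ℝ} (ht : 3 ≤ t) :
    HasDerivAt (fun s => -(Real.log s)⁻¹) ((1 / t) ^ 2 * lam t ^ 2) t := by
  have h := one_le_log ht
  have ht0 : 0 < t := by linarith
  refine ((Real.hasDerivAt_log ht0.ne').fun_inv (by positivity)).fun_neg.congr_deriv ?_
  rw [lam, div_pow (√t), Real.sq_sqrt ht0.le]
  field_simp

lemma lintegral_ofReal_lt_top_of_le_hasDerivAt {J J' h : ℝ → ℝ} {a K : ℝ}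
    (hJ : ∀ t ≥ a, HasDerivAt J (J' t) t) (h0 : ∀ t ≥ a, 0 ≤ h t) (hh : ∀ t ≥ a, h t ≤ J' t)
    (hK : ∀ t ≥ a, J t ≤ K) : ∫⁻ t in Set.Ioi a, ENNReal.ofReal (h t) < ⊤ := by
  have hmono : MonotoneOn J (Set.Ici a) := by
    refine monotoneOn_of_deriv_nonneg (convex_Ici a)
      (fun t ht => (hJ t ht).continuousAt.continuousWithinAt) (fun t ht => ?_) fun t ht => ?_
    · exact (hJ t (interior_subset ht)).differentiableAt.differentiableWithinAt
    · rw [(hJ t (interior_subset ht)).deriv]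
      exact (h0 t (interior_subset ht)).trans (hh t (interior_subset ht))
  have hlim := tendsto_atTop_ciSup (f := fun t => J (max a t))
    (fun s t hst => hmono (le_max_left a s : max a s ∈ Set.Ici a)
      (le_max_left a t : max a t ∈ Set.Ici a) (max_le_max_left a hst))
    ⟨K, by rintro _ ⟨t, rfl⟩; exact hK _ (le_max_left _ _)⟩
  have hlim' := hlim.congr' (f₂ := J)
    ((eventually_ge_atTop a).mono fun t ht => by simp only [max_eq_right ht])
  have hJint := integrableOn_Ioi_deriv_of_nonneg' hJ
    (fun t ht => (h0 t (le_of_lt ht)).trans (hh t (le_of_lt ht))) hlim'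
  refine lt_of_le_of_lt ?_ hJint.lintegral_lt_top
  exact setLIntegral_mono' measurableSet_Ioi fun t ht => ENNReal.ofReal_le_ofReal (hh t (le_of_lt ht))

lemma exists_gt_lt_of_lintegral_lt_top {g : ℝ → ℝ}
    (hg : ∫⁻ t in Set.Ioi (3 : ℝ), ENNReal.ofReal (1 / lam t * g t) < ⊤) {δ : ℝ} (hδ : 0 < δ)
    (N : ℝ) : ∃ t > N, g t < δ := by
  by_contra! hcon
  have hJint : IntegrableOn (fun t : ℝ => δ * t⁻¹) (Set.Ioi (max N 3)) := by
    have hmeas : Measurable fun t : ℝ => δ * t⁻¹ := by fun_prop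
    refine ⟨hmeas.aestronglyMeasurable, ?_⟩
    rw [hasFiniteIntegral_iff_ofReal]
    · refine lt_of_le_of_lt ?_ hg
      refine (setLIntegral_mono' measurableSet_Ioi fun t ht => ENNReal.ofReal_le_ofReal ?_).trans
        (lintegral_mono_set (Set.Ioi_subset_Ioi (le_max_right N 3)))
      obtain ⟨h1, h2⟩ := max_lt_iff.mp (Set.mem_Ioi.mp ht)
      have h3 := one_div_le_one_div_lam h2.le
      have h4 : 0 < 1 / t := by positivity
      rw [mul_comm, ← one_div]
      exact mul_le_mul h3 (hcon t h1) hδ.le (h4.le.trans h3)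
    · refine (ae_restrict_iff' measurableSet_Ioi).mpr (ae_of_all _ fun t ht => ?_)
      have h2 := (max_lt_iff.mp (Set.mem_Ioi.mp ht)).2
      have : 0 < t := by linarith
      exact (by positivity : 0 ≤ δ * t⁻¹)
  refine not_integrableOn_Ioi_inv (a := max N 3) ?_
  have h := hJint.const_mul δ⁻¹
  simp only [inv_mul_cancel_left₀ hδ.ne'] at h
  exact h

lemma exists_strictMono_tendsto_zero {g : ℝ → ℝ} (h0 : ∀ t, 0 ≤ g t)
    (hg : ∀ δ > 0, ∀ N, ∃ t > N, g t < δ) :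
    ∃ s : ℕ → ℝ, StrictMono s ∧ Tendsto s atTop atTop ∧ Tendsto (fun n => g (s n)) atTop (𝓝 0) := by
  have hg' : ∀ (n : ℕ) (N : ℝ), ∃ t > N, g t < 1 / ((n : ℝ) + 1) := fun n =>
    hg _ Nat.one_div_pos_of_nat
  choose f hfN hfg using hg'
  let s : ℕ → ℝ := fun n => Nat.rec (f 0 0) (fun n r => f (n + 1) (max r (n + 1))) n
  have hs : ∀ n, s (n + 1) = f (n + 1) (max (s n) (n + 1)) := fun n => rfl
  have hlt : ∀ n, max (s n) (n + 1) < s (n + 1) := fun n => hfN _ _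
  have hn : ∀ n : ℕ, (n : ℝ) ≤ s n := fun n => by
    cases n with
    | zero => exact Nat.cast_zero.trans_le (hfN 0 0).le
    | succ n => exact_mod_cast ((le_max_right _ _).trans_lt (hlt n)).le
  refine ⟨s, strictMono_nat_of_lt_succ fun n => (le_max_left _ _).trans_lt (hlt n),
    tendsto_atTop_mono hn tendsto_natCast_atTop_atTop,
    squeeze_zero (fun n => h0 _) (fun n => ?_) tendsto_one_div_add_atTop_nhds_zero_nat⟩
  cases n with
  | zero => exact (hfg 0 0).le
  | succ n => exact (hfg (n + 1) _).le

lemma exists_abs_le_sq_div_two {f : ℝ → ℝ} (hf : Continuous f)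
    (hlim : Tendsto (fun s : ℝ => f s / s ^ 2) (𝓝[≠] 0) (𝓝 0)) :
    ∃ ε > 0, ∀ s, |s| < ε → |f s| ≤ s ^ 2 / 2 := by
  have hf0 : f 0 = 0 := by
    have h1 : Tendsto (fun s : ℝ => f s / s ^ 2 * s ^ 2) (𝓝[≠] 0) (𝓝 (0 * 0 ^ 2)) :=
      hlim.mul (((continuous_pow 2).tendsto 0).mono_left nhdsWithin_le_nhds)
    rw [zero_mul] at h1
    refine tendsto_nhds_unique ((hf.tendsto 0).mono_left nhdsWithin_le_nhds) (h1.congr' ?_)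
    filter_upwards [self_mem_nhdsWithin] with s hs
    exact div_mul_cancel₀ _ (pow_ne_zero 2 hs)
  obtain ⟨ε, hε, h⟩ := (Metric.tendsto_nhdsWithin_nhds.mp hlim) (1 / 2) (by norm_num)
  refine ⟨ε, hε, fun s hs => ?_⟩
  rcases eq_or_ne s 0 with rfl | hs0
  · simp [hf0]
  have h1 := h hs0 (by simpa using hs)
  have h2 : 0 < s ^ 2 := by positivity
  rw [dist_zero_right, Real.norm_eq_abs, abs_div, abs_of_pos h2, div_lt_iff₀ h2] at h1
  linarith

lemma abs_le_of_hasDerivAt_of_abs_le_sq {f F : ℝ → ℝ} {ε : ℝ} (hF0 : F 0 = 0)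
    (hF : ∀ s, HasDerivAt F (f s) s) (hf : ∀ s, |s| < ε → |f s| ≤ s ^ 2 / 2) {s : ℝ}
    (hs : |s| < ε) (hs1 : |s| ≤ 1) : |F s| ≤ s ^ 2 / 2 := by
  have hr : ∀ r ∈ Set.uIcc 0 s, ‖f r‖ ≤ s ^ 2 / 2 := fun r hr => by
    have h1 : |r| ≤ |s| := by simpa using Set.abs_sub_left_of_mem_uIcc hr
    have h2 := hf r (h1.trans_lt hs)
    have h3 := sq_le_sq.mpr h1
    rw [Real.norm_eq_abs]
    linarith
  have h := (convex_uIcc 0 s).norm_image_sub_le_of_norm_hasDerivWithin_le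
    (fun r _ => (hF r).hasDerivWithinAt) hr Set.left_mem_uIcc Set.right_mem_uIcc
  rw [hF0, sub_zero, sub_zero, Real.norm_eq_abs, Real.norm_eq_abs] at h
  exact h.trans (mul_le_of_le_one_right (by positivity) hs1)

/-- Averaged local L² decay of the derivative: for small solutions of
`∂ₜu + ∂ₓ(∂ₓ²u + u² + f₂(u)) = 0`, bounded in L¹ uniformly in time,
`∫₂^∞ λ(t)⁻¹ ∫ sech⁴(x/λ(t)) (∂ₓu)² dx dt < ∞` and the local L² norm of `∂ₓu`
vanishes along a sequence of times going to infinity. -/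
theorem gkdv_local_L2_average_decay_derivative
    (f2 : ℝ → ℝ) (hf2 : ContDiff ℝ 2 f2)
    (hlim : Tendsto (fun s : ℝ => f2 s / s ^ 2) (𝓝[≠] 0) (𝓝 0))
    (F2 : ℝ → ℝ) (hF20 : F2 0 = 0) (hF2' : ∀ s : ℝ, HasDerivAt F2 (f2 s) s) :
    ∃ ε > 0, ∀ u : ℝ → ℝ → ℝ,
      (∀ x, ContDiff ℝ 1 (fun t => u t x)) →
      (∀ t, ContDiff ℝ 3 (fun x => u t x)) →
      (∀ t x, deriv (fun s => u s x) t
          + deriv (fun y => deriv (deriv (u t)) y + (u t y) ^ 2 + f2 (u t y)) x = 0) →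
      (∀ t, Integrable (fun x => (u t x) ^ 2)) →
      (∀ t, Integrable (fun x => (deriv (u t) x) ^ 2)) →
      (∀ t, Integrable (u t)) →
      (∃ M : ℝ, ∀ t, (∫ x, |u t x|) ≤ M) →
      -- the virial identities (valid thanks to the decay in x of the solution)
      (∀ ψ : ℝ → ℝ, ContDiff ℝ 3 ψ → (∃ M : ℝ, ∀ n ≤ 3, ∀ x, |iteratedDeriv n ψ x| ≤ M) →
        ∀ t > 2, HasDerivAt (fun s => ∫ x, ψ (x / lam s) * u s x)
          (-(deriv lam t / lam t) * (∫ x, (x / lam t) * deriv ψ (x / lam t) * u t x)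
            + (1 / (lam t) ^ 3) * (∫ x, deriv (deriv (deriv ψ)) (x / lam t) * u t x)
            + (1 / lam t) * ∫ x, deriv ψ (x / lam t) * ((u t x) ^ 2 + f2 (u t x))) t) →
      (∀ φ : ℝ → ℝ, ContDiff ℝ 3 φ → (∃ M : ℝ, ∀ n ≤ 3, ∀ x, |iteratedDeriv n φ x| ≤ M) →
        ∀ t > 2, HasDerivAt (fun s => (1/2) * ∫ x, φ (x / lam s) * (u s x) ^ 2)
          (-(deriv lam t / (2 * lam t)) *
              (∫ x, (x / lam t) * deriv φ (x / lam t) * (u t x) ^ 2)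
            - (3 / (2 * lam t)) * (∫ x, deriv φ (x / lam t) * (deriv (u t) x) ^ 2)
            + (1 / (2 * (lam t) ^ 3)) *
                (∫ x, deriv (deriv (deriv φ)) (x / lam t) * (u t x) ^ 2)
            + (1 / lam t) * ∫ x, deriv φ (x / lam t) *
                ((2/3) * (u t x) ^ 3 + u t x * f2 (u t x) - F2 (u t x))) t) →
      -- smallness in H¹, uniformly in time
      (∀ t, Real.sqrt (∫ x, ((u t x) ^ 2 + (deriv (u t) x) ^ 2)) < ε) →
      (∫⁻ t in Set.Ioi (2:ℝ), ∫⁻ x : ℝ,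
          ENNReal.ofReal ((1 / lam t) * ((Real.cosh (x / lam t))⁻¹) ^ 4
            * (deriv (u t) x) ^ 2)) < ⊤
      ∧ ∃ sn : ℕ → ℝ, StrictMono sn ∧ Tendsto sn atTop atTop ∧
          Tendsto (fun n => ∫ x, ((Real.cosh (x / lam (sn n)))⁻¹) ^ 4
            * (deriv (u (sn n)) x) ^ 2) atTop (𝓝 0) := by
  obtain ⟨ε, hε, hf⟩ := exists_abs_le_sq_div_two hf2.continuous hlim
  refine ⟨min ε 1, lt_min hε one_pos, ?_⟩
  intro u _ hux _ hu2 hdu2 hu1 hM hvir1 hvir2 hsmall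
  obtain ⟨M, hM⟩ := hM
  have henergy : ∀ t, ∫ x, (u t x ^ 2 + deriv (u t) x ^ 2) < (min ε 1) ^ 2 := fun t =>
    (Real.sqrt_lt' (lt_min hε one_pos)).mp (hsmall t)
  have hmin : (min ε 1) ^ 2 ≤ 1 := pow_le_one₀ (lt_min hε one_pos).le (min_le_right _ _)
  have hsup : ∀ t x, |u t x| < min ε 1 := fun t x =>
    abs_lt_of_sq_lt_sq ((sq_le_integral_sq_add_deriv_sq ((hux t).of_le (by norm_num))
      (hu2 t) (hdu2 t) x).trans_lt (henergy t)) (lt_min hε one_pos).le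
  have hle1 : ∀ t x, |u t x| ≤ 1 := fun t x => (hsup t x).le.trans (min_le_right _ _)
  have hfu : ∀ t x, |f2 (u t x)| ≤ u t x ^ 2 / 2 := fun t x =>
    hf _ ((hsup t x).trans_le (min_le_left _ _))
  have hFu : ∀ t x, |F2 (u t x)| ≤ u t x ^ 2 / 2 := fun t x =>
    abs_le_of_hasDerivAt_of_abs_le_sq hF20 hF2' hf ((hsup t x).trans_le (min_le_left _ _)) (hle1 t x)
  have hflux : ∀ t x, |2 / 3 * u t x ^ 3 + u t x * f2 (u t x) - F2 (u t x)| ≤ 2 * u t x ^ 2 :=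
    fun t x => by
    have h1 : |2 / 3 * u t x ^ 3| ≤ 2 / 3 * u t x ^ 2 := by
      rw [pow_succ, abs_mul, abs_mul, abs_of_nonneg (sq_nonneg (u t x)), abs_of_pos (by norm_num)]
      gcongr
      exact mul_le_of_le_one_right (sq_nonneg _) (hle1 t x)
    have h2 : |u t x * f2 (u t x)| ≤ 1 * (u t x ^ 2 / 2) := by
      rw [abs_mul]
      exact mul_le_mul (hle1 t x) (hfu t x) (abs_nonneg _) zero_le_one
    have h3 := hFu t x
    rw [abs_le] at h1 h2 h3 ⊢
    constructor <;> linarith [sq_nonneg (u t x)]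
  have hE2 : ∀ t, ∫ x, u t x ^ 2 ≤ 1 := fun t => by
    refine le_trans ?_ ((henergy t).le.trans hmin)
    exact integral_mono (hu2 t) ((hu2 t).add (hdu2 t)) fun x => le_add_of_nonneg_right (sq_nonneg _)
  have hD2 : ∀ t, ∫ x, deriv (u t) x ^ 2 ≤ 1 := fun t => by
    refine le_trans ?_ ((henergy t).le.trans hmin)
    exact integral_mono (hdu2 t) ((hu2 t).add (hdu2 t)) fun x => le_add_of_nonneg_left (sq_nonneg _)
  have hM0 : 0 ≤ M := (integral_nonneg fun x => abs_nonneg (u 0 x)).trans (hM 0)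
  set G : ℝ → ℝ := fun t => ∫ x, (Real.cosh (x / lam t))⁻¹ ^ 4 * deriv (u t) x ^ 2 with hG
  have hG0 : ∀ t, 0 ≤ G t := fun t => integral_nonneg fun x => by positivity
  have hGi : ∀ t, Integrable fun x => (Real.cosh (x / lam t))⁻¹ ^ 4 * deriv (u t) x ^ 2 :=
    fun t => integrable_sech_pow_mul (hdu2 t) 4 (lam t)
  have hG1 : ∀ t, G t ≤ 1 := fun t => by
    refine (integral_mono (hGi t) (hdu2 t) fun x => ?_).trans (hD2 t)
    exact mul_le_of_le_one_left (sq_nonneg _) (le_of_abs_le (abs_sech_pow_le_one 4 _))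
  have hinner : ∀ t > 2, (∫⁻ x : ℝ, ENNReal.ofReal ((1 / lam t) * ((Real.cosh (x / lam t))⁻¹) ^ 4
      * (deriv (u t) x) ^ 2)) = ENNReal.ofReal (1 / lam t * G t) := fun t ht => by
    have hl := lam_pos (by linarith : 1 < t)
    rw [hG, ← integral_const_mul, ofReal_integral_eq_lintegral_ofReal ((hGi t).const_mul _)
      (ae_of_all _ fun x => by positivity)]
    simp only [mul_assoc]
  have hfar : ∫⁻ t in Set.Ioi (3 : ℝ), ENNReal.ofReal (1 / lam t * G t) < ⊤ := by
    have hJ : ∀ t ≥ 3, HasDerivAt (fun s => 100 * (∫ x, Real.tanh (x / lam s) * u s x)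
        - 1 / 2 * (∫ x, sechFourPrimitive (x / lam s) * u s x ^ 2)
        + 100 * (8 * Real.pi * (-(Real.log s)⁻¹) - 27648 * M * s ^ (-(1 / 4) : ℝ))) _ t :=
      fun t ht => by
      have ht0 : t ≠ 0 := by linarith
      exact (((hvir1 Real.tanh contDiff_tanh exists_bound_iteratedDeriv_tanh t
        (by linarith)).const_mul 100).fun_sub
        (hvir2 sechFourPrimitive contDiff_sechFourPrimitive
          exists_bound_iteratedDeriv_sechFourPrimitive t (by linarith))).fun_add
        ((((hasDerivAt_neg_inv_log ht).const_mul (8 * Real.pi)).fun_sub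
          ((Real.hasDerivAt_rpow_const (p := -(1 / 4)) (Or.inl ht0)).const_mul
            (27648 * M))).const_mul 100)
    refine lintegral_ofReal_lt_top_of_le_hasDerivAt (K := 100 * M + 1) hJ
      (fun t ht => ?_) (fun t ht => ?_) (fun t ht => ?_)
    · have hl := lam_pos (by linarith : 1 < t)
      exact mul_nonneg (by positivity) (hG0 t)
    · have hl := lam_pos (by linarith : 1 < t)
      have hl2 := one_div_lam_le_two (by linarith : 1 < t)
      have hc := abs_deriv_lam_div_lam_le ht
      have ht1 := one_div_le_one_div_lam ht
      have hc' : |deriv lam t / (2 * lam t)| ≤ 1 / lam t := by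
        rw [mul_comm, ← div_div, abs_div, abs_two]
        linarith [abs_nonneg (deriv lam t / lam t)]
      have b1 := le_virial_of_mass (hu1 t) (hu2 t) (hM t)
        (hf2.continuous.comp (hux t).continuous) (hfu t) hl hc
      have b2 := virial_of_energy_le (D := 3 / (2 * lam t) * G t) (hu2 t) (hflux t) hl2 hl hc'
      have b3 := mul_le_mul_of_nonneg_left (one_div_lam_pow_three_le ht) hM0
      have hA : 0 ≤ 1 / lam t * ∫ x, (Real.cosh (x / lam t))⁻¹ ^ 2 * u t x ^ 2 :=
        mul_nonneg (by positivity) (integral_nonneg fun x => by positivity)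
      have hGt : 0 ≤ 1 / lam t * G t := mul_nonneg (by positivity) (hG0 t)
      have e3 : 3 / (2 * lam t) * G t = 3 / 2 * (1 / lam t * G t) := by
        field_simp
      have e4 : (-(1 / 4) - 1 : ℝ) = -(5 / 4) := by norm_num
      rw [deriv_deriv_deriv_tanh, deriv_tanh, deriv_deriv_deriv_sechFourPrimitive,
        deriv_sechFourPrimitive, e4]
      beta_reduce
      simp only [Function.comp_apply] at b1
      rw [e3] at b2
      linarith
    · have c1 : ∫ x, Real.tanh (x / lam t) * u t x ≤ M := by
        refine (le_abs_self _).trans (le_trans ?_ (hM t))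
        rw [← Real.norm_eq_abs]
        refine norm_integral_le_of_norm_le (hu1 t).abs (ae_of_all _ fun x => ?_)
        rw [norm_mul]
        exact mul_le_of_le_one_left (norm_nonneg _) (abs_tanh_le_one _)
      have c2 : |∫ x, sechFourPrimitive (x / lam t) * u t x ^ 2| ≤ 2 * 1 := by
        refine le_trans ?_ (mul_le_mul_of_nonneg_left (hE2 t) zero_le_two)
        rw [← Real.norm_eq_abs, ← integral_const_mul]
        refine norm_integral_le_of_norm_le ((hu2 t).const_mul 2) (ae_of_all _ fun x => ?_)
        rw [norm_mul, Real.norm_of_nonneg (sq_nonneg (u t x))]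
        exact mul_le_mul_of_nonneg_right (abs_sechFourPrimitive_le_two _) (sq_nonneg _)
      have c3 := one_le_log ht
      have c4 : 0 ≤ 8 * Real.pi * (Real.log t)⁻¹ := by positivity
      have c5 : 0 ≤ 27648 * M * t ^ (-(1 / 4) : ℝ) :=
        mul_nonneg (by positivity) (Real.rpow_nonneg (by linarith) _)
      have c6 := (abs_le.mp c2).1
      linarith
  refine ⟨?_, exists_strictMono_tendsto_zero hG0 fun δ hδ N =>
    exists_gt_lt_of_lintegral_lt_top hfar hδ N⟩
  rw [setLIntegral_congr_fun measurableSet_Ioi fun t ht => hinner t ht,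
    ← Set.Ioc_union_Ioi_eq_Ioi (by norm_num : (2 : ℝ) ≤ 3)]
  refine (lintegral_union_le _ _ _).trans_lt (ENNReal.add_lt_top.mpr ⟨?_, hfar⟩)
  refine (setLIntegral_mono' (g := fun _ => ENNReal.ofReal 2) measurableSet_Ioc fun t ht =>
    ENNReal.ofReal_le_ofReal ?_).trans_lt ?_
  · have h1 := one_div_lam_le_two (by linarith [ht.1] : 1 < t)
    linarith [mul_le_mul h1 (hG1 t) (hG0 t) zero_le_two]
  · rw [setLIntegral_const, Real.volume_Ioc]
    exact ENNReal.mul_lt_top ENNReal.ofReal_lt_top ENNReal.ofReal_lt_top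
end
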